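/- arXiv:2603.28349 — 3 statements merged into one kernel-verified Lean document; each statement's English description precedes it below -/
import Mathlib

section
/- Let N ≥ 2, and for each site n ∈ ℤ/N let A^{[n]} : Fin d → Matrix (Fin D) (Fin D) ℂ be an MPS tensor, h^{[n]} a 2-site operator on ℂ^d ⊗ ℂ^d, and B^{[n]} : Fin d → Matrix (Fin D) (Fin D) ℂ, such that for all n ∈ ℤ/N and all i, j ∈ Fin d: Σ_{i', j' ∈ Fin d} (h^{[n]})^{i j}_{i' j'} A^{[n], i'} A^{[n+1], j'} = A^{[n], i} B^{[n+1], j} − B^{[n], i} A^{[n+1], j} (matrix products). Then the (not necessarily translation-invariant) matrix product state ψ with coefficients ψ(i_1, …, i_N) = Tr(A^{[1], i_1} A^{[2], i_2} ⋯ A^{[N], i_N}) is annihilated by the inhomogeneous Hamiltonian: Σ_{n=1}^N (h^{[n]})_{n, n+1} ψ = 0, where (h^{[n]})_{n,n+1} denotes h^{[n]} acting on sites n, n+1 (mod N) of (ℂ^d)^{⊗N}. -/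
open Matrix
open scoped ComplexOrder

/-- Cyclic shift of a site index: `cyc a t` is `a + t (mod N)`. -/
def cyc {N : ℕ} (a : Fin N) (t : ℕ) : Fin N :=
  ⟨(a.val + t) % N, Nat.mod_lt _ (Nat.lt_of_le_of_lt (Nat.zero_le _) a.isLt)⟩

/-- Ordered product `A^{i_1} ⋯ A^{i_m}`. -/
noncomputable def prodA {d D m : ℕ} (A : Fin d → Matrix (Fin D) (Fin D) ℂ)
    (i : Fin m → Fin d) : Matrix (Fin D) (Fin D) ℂ :=
  (List.ofFn fun t => A (i t)).prod

/-- Matrix product state on `N` cyclic sites: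
`ψ_N(i_1,…,i_N) = Tr(A^{i_1} ⋯ A^{i_N})`. -/
noncomputable def mps {d D : ℕ} (A : Fin d → Matrix (Fin D) (Fin D) ℂ) (N : ℕ) :
    (Fin N → Fin d) → ℂ :=
  fun i => (prodA A i).trace

/-- A `k`-site operator `o` acting on sites `n, n+1, …, n+k-1 (mod N)` of a
periodic chain of `N` sites, as a matrix on the full configuration space. -/
noncomputable def localOp {d k N : ℕ}
    (o : Matrix (Fin k → Fin d) (Fin k → Fin d) ℂ) (n : Fin N) :
    Matrix (Fin N → Fin d) (Fin N → Fin d) ℂ :=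
  Matrix.of fun x y =>
    o (fun t => x (cyc n t.val)) (fun t => y (cyc n t.val)) *
      (if ∀ m : Fin N, (∀ t : Fin k, m ≠ cyc n t.val) → x m = y m then 1 else 0)

/-- `O_N = Σ_{n=1}^N o_n`, the sum of all translates of a `k`-site operator. -/
noncomputable def opSum {d k N : ℕ}
    (o : Matrix (Fin k → Fin d) (Fin k → Fin d) ℂ) :
    Matrix (Fin N → Fin d) (Fin N → Fin d) ℂ :=
  ∑ n : Fin N, localOp o n

/-- `A` is injective with injectivity length `L`: the map
`Γ_L : X ↦ (Tr(X A^{i_1} ⋯ A^{i_L}))_{i}` is injective. -/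
noncomputable def InjectiveLen {d D : ℕ} (A : Fin d → Matrix (Fin D) (Fin D) ℂ)
    (L : ℕ) : Prop :=
  Function.Injective fun X : Matrix (Fin D) (Fin D) ℂ =>
    fun i : Fin L → Fin d => (X * prodA A i).trace

/-- `ρL, ρR` are positive definite fixed points of the transfer operator of `A`. -/
def TransferFixedPoints {d D : ℕ} (A : Fin d → Matrix (Fin D) (Fin D) ℂ)
    (ρL ρR : Matrix (Fin D) (Fin D) ℂ) : Prop :=
  ρL.PosDef ∧ ρR.PosDef ∧
    (∑ i, (A i)ᴴ * ρL * A i) = ρL ∧ (∑ i, A i * ρR * (A i)ᴴ) = ρR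

/-- `B` satisfies the local telescoping equation for `(A, o, ε)`, where `o` is a
`(k+1)`-site operator and `B` is a family of matrices indexed by `k`-tuples:
`Σ_j o^{i}_{j} A^{j_0}⋯A^{j_k} − ε A^{i_0}⋯A^{i_k}
  = A^{i_0} B^{i_1…i_k} − B^{i_0…i_{k-1}} A^{i_k}`. -/
noncomputable def Telescopes {d D k : ℕ} (A : Fin d → Matrix (Fin D) (Fin D) ℂ)
    (o : Matrix (Fin (k+1) → Fin d) (Fin (k+1) → Fin d) ℂ) (ε : ℂ)
    (B : (Fin k → Fin d) → Matrix (Fin D) (Fin D) ℂ) : Prop :=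
  ∀ i : Fin (k+1) → Fin d,
    (∑ j : Fin (k+1) → Fin d, o i j • prodA A j) - ε • prodA A i
      = A (i 0) * B (fun t => i t.succ) - B (fun t => i t.castSucc) * A (i (Fin.last k))

/-- Site-dependent matrix product state:
`ψ(i_1,…,i_N) = Tr(A^{[1],i_1} ⋯ A^{[N],i_N})`. -/
noncomputable def mpsInhom {d D N : ℕ}
    (A : Fin N → Fin d → Matrix (Fin D) (Fin D) ℂ) :
    (Fin N → Fin d) → ℂ :=
  fun i => ((List.ofFn fun n => A n (i n)).prod).trace

open Function in
/-- The action of a 2-site operator on sites `n, n+1`, as a sum over the two local indices. -/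
lemma localOp_two_mulVec {d k : ℕ} (o : Matrix (Fin 2 → Fin d) (Fin 2 → Fin d) ℂ)
    (n : Fin (k + 2)) (f : (Fin (k + 2) → Fin d) → ℂ) (x : Fin (k + 2) → Fin d)
    (hne : cyc n 1 ≠ n) :
    (localOp o n).mulVec f x = ∑ i : Fin d, ∑ j : Fin d,
      o ![x n, x (cyc n 1)] ![i, j] * f (update (update x n i) (cyc n 1) j) := by
  have h0 : cyc n 0 = n := Fin.ext (Nat.mod_eq_of_lt n.isLt)
  have hvec (z : Fin (k + 2) → Fin d) :
      (fun t : Fin 2 => z (cyc n t.val)) = ![z n, z (cyc n 1)] := by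
    ext t
    fin_cases t <;> simp [h0]
  simp only [Matrix.mulVec, dotProduct, localOp, Matrix.of_apply, hvec, Fin.forall_fin_two,
    Fin.val_zero, Fin.val_one, h0, mul_ite, mul_one, mul_zero, ite_mul, zero_mul]
  rw [← Finset.sum_filter, ← Fintype.sum_prod_type']
  have hglue (y : Fin (k + 2) → Fin d) (hy : ∀ m, m ≠ n ∧ m ≠ cyc n 1 → x m = y m) :
      update (update x n (y n)) (cyc n 1) (y (cyc n 1)) = y := by
    ext m
    by_cases h2 : m = cyc n 1
    · subst h2; simp
    by_cases h1 : m = n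
    · subst h1; simp [h2]
    simp [h1, h2, hy m ⟨h1, h2⟩]
  refine Finset.sum_bij' (fun y _ => (y n, y (cyc n 1)))
    (fun p _ => update (update x n p.1) (cyc n 1) p.2) (by simp) ?_ ?_ ?_ ?_
  · intro p _
    simp only [Finset.mem_filter, Finset.mem_univ, true_and]
    rintro m ⟨h1, h2⟩
    simp [h1, h2]
  · intro y hy
    exact hglue y (Finset.mem_filter.mp hy).2
  · rintro ⟨i, j⟩ _
    simp [update_of_ne hne.symm]
  · intro y hy
    simp only [hglue y (Finset.mem_filter.mp hy).2]

/-- The trace of an ordered product is invariant under a cyclic shift of the factors. -/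
lemma trace_prod_ofFn_cyc {D N : ℕ} (M : Fin N → Matrix (Fin D) (Fin D) ℂ) (n : Fin N) :
    ((List.ofFn M).prod).trace = ((List.ofFn fun t : Fin N => M (cyc n t.val)).prod).trace := by
  have hrot : (List.ofFn fun t : Fin N => M (cyc n t.val)) = (List.ofFn M).rotate n.val := by
    apply List.ext_getElem
    · simp
    · intro t h1 h2
      simp [List.getElem_rotate, cyc, add_comm]
  rw [hrot, List.rotate_eq_drop_append_take (by simp [n.isLt.le]), List.prod_append,
    Matrix.trace_mul_comm, ← List.prod_append, List.take_append_drop]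

open Function in
/-- The trace of an ordered product, as a function of the factors at `n` and `n+1`. -/
lemma exists_trace_prod_ofFn_update {D k : ℕ} (M : Fin (k + 2) → Matrix (Fin D) (Fin D) ℂ)
    (n : Fin (k + 2)) (hne : cyc n 1 ≠ n) :
    ∃ R : Matrix (Fin D) (Fin D) ℂ, ∀ X Y : Matrix (Fin D) (Fin D) ℂ,
      ((List.ofFn (update (update M n X) (cyc n 1) Y)).prod).trace = (X * Y * R).trace := by
  have hinj (s t : ℕ) (hs : s < k + 2) (ht : t < k + 2) (hst : cyc n s = cyc n t) : s = t := by
    have hmod : s ≡ t [MOD k + 2] := Nat.ModEq.add_left_cancel' n.val (Fin.ext_iff.mp hst)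
    exact hmod.eq_of_lt_of_lt hs ht
  have h0 : cyc n 0 = n := Fin.ext (Nat.mod_eq_of_lt n.isLt)
  refine ⟨(List.ofFn fun t : Fin k => M (cyc n (t.val + 2))).prod, fun X Y => ?_⟩
  have hrest (t : Fin k) :
      update (update M n X) (cyc n 1) Y (cyc n (t.val + 2)) = M (cyc n (t.val + 2)) := by
    rw [update_of_ne, update_of_ne]
    · intro h
      have := hinj (t.val + 2) 0 (by omega) (by omega) (h.trans h0.symm)
      omega
    · intro h
      have := hinj (t.val + 2) 1 (by omega) (by omega) h
      omega
  rw [trace_prod_ofFn_cyc _ n, List.ofFn_succ, List.ofFn_succ]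
  simp [h0, hrest, update_of_ne hne.symm, mul_assoc]

/-- For a site-dependent MPS with site-dependent 2-site
operators `h^{[n]}` and tensors `B^{[n]}` satisfying the inhomogeneous local
telescoping equation
`Σ_{i',j'} (h^{[n]})^{ij}_{i'j'} A^{[n],i'} A^{[n+1],j'}
  = A^{[n],i} B^{[n+1],j} − B^{[n],i} A^{[n+1],j}`,
the state `ψ` is annihilated by `Σ_n (h^{[n]})_{n,n+1}`. -/
theorem inhomogeneous_mps_annihilated
    (d D N : ℕ) (hd : 1 ≤ d) (hD : 1 ≤ D) (hN : 2 ≤ N)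
    (A : Fin N → Fin d → Matrix (Fin D) (Fin D) ℂ)
    (h : Fin N → Matrix (Fin 2 → Fin d) (Fin 2 → Fin d) ℂ)
    (B : Fin N → Fin d → Matrix (Fin D) (Fin D) ℂ)
    (hloc : ∀ (n : Fin N) (i j : Fin d),
      (∑ i' : Fin d, ∑ j' : Fin d,
          h n ![i, j] ![i', j'] • (A n i' * A (cyc n 1) j'))
        = A n i * B (cyc n 1) j - B n i * A (cyc n 1) j) :
    (∑ n : Fin N, localOp (h n) n).mulVec (mpsInhom A) = 0 := by
  obtain ⟨k, rfl⟩ : ∃ k, N = k + 2 := ⟨N - 2, by omega⟩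
  have hcyc (n : Fin (k + 2)) : cyc n 1 = n + 1 := by
    ext
    simp [cyc, Fin.val_add]
  have hne (n : Fin (k + 2)) : cyc n 1 ≠ n := by simp [hcyc]
  ext x
  let T (n : Fin (k + 2)) : ℂ :=
    ((List.ofFn (Function.update (fun m => A m (x m)) n (B n (x n)))).prod).trace
  have hterm (n : Fin (k + 2)) :
      (localOp (h n) n).mulVec (mpsInhom A) x = T (n + 1) - T n := by
    obtain ⟨R, hR⟩ := exists_trace_prod_ofFn_update (fun m => A m (x m)) n (hne n)
    have hA (i j : Fin d) :
        mpsInhom A (Function.update (Function.update x n i) (cyc n 1) j)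
          = (A n i * A (cyc n 1) j * R).trace := by
      rw [← hR, mpsInhom]
      congr 3
      ext1 m
      by_cases h2 : m = cyc n 1
      · subst h2; simp
      by_cases h1 : m = n
      · subst h1; simp [h2]
      simp [h1, h2]
    have hT : T n = (B n (x n) * A (cyc n 1) (x (cyc n 1)) * R).trace := by
      rw [← hR, Function.update_comm (hne n).symm]
      simp [T]
    have hT' : T (n + 1) = (A n (x n) * B (cyc n 1) (x (cyc n 1)) * R).trace := by
      rw [← hR, ← hcyc]
      simp [T]
    rw [localOp_two_mulVec _ _ _ _ (hne n), hT, hT', ← Matrix.trace_sub, ← sub_mul, ← hloc]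
    simp [hA, Finset.sum_mul, Matrix.trace_sum]
  rw [Matrix.sum_mulVec, Finset.sum_apply]
  simp only [hterm, Finset.sum_sub_distrib, Pi.zero_apply]
  rw [sub_eq_zero]
  exact Equiv.sum_comp (Equiv.addRight (1 : Fin (k + 2))) T
end

section
/- Let T : Fin d → Fin d → Matrix (Fin D) (Fin D) ℂ define a matrix product operator O^{MPO}_N on (ℂ^d)^{⊗N} by O^{MPO}_N = Σ_{i⃗, j⃗ ∈ (Fin d)^N} Tr(T^{i_1 j_1} T^{i_2 j_2} ⋯ T^{i_N j_N}) |i_1…i_N⟩⟨j_1…j_N|. Suppose the vectorized tensor T̂ : Fin d × Fin d → Matrix (Fin D) (Fin D) ℂ, T̂^{(i,j)} := T^{i j}, viewed as an MPS tensor with physical dimension d², is injective with injectivity length L and admits positive definite transfer fixed points. Let h be a 2-site operator on ℂ^d ⊗ ℂ^d, H_N := Σ_{n=1}^N h_n (periodic boundary), and N > 2L + 3. Then [H_N, O^{MPO}_N] = 0 if and only if there exists a family B : Fin d → Fin d → Matrix (Fin D) (Fin D) ℂ such that for all i_1, i_2, j_1, j_2 ∈ Fin d: Σ_{k_1, k_2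 ∈ Fin d} h^{i_1 i_2}_{k_1 k_2} T^{k_1 j_1} T^{k_2 j_2} − Σ_{k_1, k_2 ∈ Fin d} T^{i_1 k_1} T^{i_2 k_2} h^{k_1 k_2}_{j_1 j_2} = T^{i_1 j_1} B^{i_2 j_2} − B^{i_1 j_1} T^{i_2 j_2} (matrix products). -/
open Matrix
open scoped ComplexOrder

/-- Matrix product operator on `N` cyclic sites:
`O^{MPO}_N = Σ_{i,j} Tr(T^{i_1 j_1} ⋯ T^{i_N j_N}) |i⟩⟨j|`. -/
noncomputable def mpo {d D N : ℕ}
    (T : Fin d → Fin d → Matrix (Fin D) (Fin D) ℂ) :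
    Matrix (Fin N → Fin d) (Fin N → Fin d) ℂ :=
  Matrix.of fun i j => ((List.ofFn fun n => T (i n) (j n)).prod).trace

/-- Injectivity with injectivity length `L` for an MPS tensor over an arbitrary
physical index type `ι`. -/
noncomputable def InjectiveLen' {ι : Type*} {D : ℕ}
    (A : ι → Matrix (Fin D) (Fin D) ℂ) (L : ℕ) : Prop :=
  Function.Injective fun X : Matrix (Fin D) (Fin D) ℂ =>
    fun i : Fin L → ι => (X * (List.ofFn fun t => A (i t)).prod).trace

/-- Positive definite transfer fixed points for an MPS tensor over an arbitrary
finite physical index type. -/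
def TransferFixedPoints' {ι : Type*} [Fintype ι] {D : ℕ}
    (A : ι → Matrix (Fin D) (Fin D) ℂ)
    (ρL ρR : Matrix (Fin D) (Fin D) ℂ) : Prop :=
  ρL.PosDef ∧ ρR.PosDef ∧
    (∑ i, (A i)ᴴ * ρL * A i) = ρL ∧ (∑ i, A i * ρR * (A i)ᴴ) = ρR

section MatrixWords

variable {ι n : Type*} [Fintype n] [DecidableEq n]

/-- Ordered product `A a₁ ⋯ A aₖ` along a word. -/
def wordProd (A : ι → Matrix n n ℂ) (l : List ι) : Matrix n n ℂ :=
  (l.map A).prod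

/-- Sum over all positions of a word of the ordered product of `A` in which the factor at that
position is replaced by `E`. -/
def insertSum (A E : ι → Matrix n n ℂ) : List ι → Matrix n n ℂ
  | [] => 0
  | a :: l => E a * wordProd A l + A a * insertSum A E l

/-- Sum over all pairs of adjacent positions of a word of the ordered product of `A` in which the
two factors at these positions are replaced by `F`. -/
def pairSum (A : ι → Matrix n n ℂ) (F : ι → ι → Matrix n n ℂ) : List ι → Matrix n n ℂ
  | [] => 0
  | [_] => 0
  | a :: b :: l => F a b * wordProd A l + A a * pairSum A F (b :: l)

/-- The products of `A` along words of length `k` separate matrices in the trace pairing. -/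
def WordSeparating (A : ι → Matrix n n ℂ) (k : ℕ) : Prop :=
  ∀ X : Matrix n n ℂ, (∀ l : List ι, l.length = k → (X * wordProd A l).trace = 0) → X = 0

@[simp] lemma wordProd_nil (A : ι → Matrix n n ℂ) : wordProd A [] = 1 := rfl

@[simp] lemma wordProd_cons (A : ι → Matrix n n ℂ) (a : ι) (l : List ι) :
    wordProd A (a :: l) = A a * wordProd A l := by simp [wordProd]

@[simp] lemma wordProd_append (A : ι → Matrix n n ℂ) (l l' : List ι) :
    wordProd A (l ++ l') = wordProd A l * wordProd A l' := by simp [wordProd]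

lemma insertSum_append (A E : ι → Matrix n n ℂ) (l l' : List ι) :
    insertSum A E (l ++ l') =
      insertSum A E l * wordProd A l' + wordProd A l * insertSum A E l' := by
  induction l with
  | nil => simp [insertSum]
  | cons a l ih =>
    simp only [List.cons_append, insertSum, ih, wordProd_append, wordProd_cons]
    noncomm_ring

@[simp] lemma insertSum_singleton (A E : ι → Matrix n n ℂ) (a : ι) :
    insertSum A E [a] = E a := by simp [insertSum]

lemma pairSum_append (A : ι → Matrix n n ℂ) (F : ι → ι → Matrix n n ℂ) (p w : List ι) (t b : ι) :
    pairSum A F (p ++ [t] ++ b :: w) =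
      pairSum A F (p ++ [t]) * wordProd A (b :: w) + wordProd A p * F t b * wordProd A w
        + wordProd A (p ++ [t]) * pairSum A F (b :: w) := by
  induction p with
  | nil => simp [pairSum]
  | cons a p ih =>
    cases p with
    | nil =>
      simp only [List.nil_append, List.cons_append, pairSum, wordProd_cons, wordProd_nil] at ih ⊢
      noncomm_ring
    | cons c p =>
      simp only [List.cons_append, pairSum] at ih ⊢
      rw [ih]
      simp only [wordProd_cons, wordProd_append]
      noncomm_ring

/-- If `F a b = A a * C b - B a * A b`, the sum over adjacent pairs telescopes. -/
lemma pairSum_of_telescoping {A B C : ι → Matrix n n ℂ} {F : ι → ι → Matrix n n ℂ}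
    (hF : ∀ a b, F a b = A a * C b - B a * A b) (a z : ι) (v : List ι) :
    pairSum A F (a :: (v ++ [z])) =
      A a * insertSum A C (v ++ [z]) - insertSum A B (a :: v) * A z := by
  induction v generalizing a with
  | nil => simp [pairSum, insertSum, hF]
  | cons b v ih =>
    rw [List.cons_append, pairSum, ih, hF]
    simp only [insertSum, wordProd_cons, wordProd_append, wordProd_nil]
    noncomm_ring

lemma insertSum_sub (A B C : ι → Matrix n n ℂ) (l : List ι) :
    insertSum A (fun a => C a - B a) l = insertSum A C l - insertSum A B l := by
  induction l with
  | nil => simp [insertSum]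
  | cons a l ih => simp only [insertSum, ih]; noncomm_ring

/-- With `F a b = A a * C b - B a * A b`, the cyclic sum over adjacent pairs reduces to a cyclic
sum over single positions. -/
lemma trace_cyclic_pairSum_of_telescoping {A B C : ι → Matrix n n ℂ} {F : ι → ι → Matrix n n ℂ}
    (hF : ∀ a b, F a b = A a * C b - B a * A b) (a z : ι) (v : List ι) :
    (pairSum A F (a :: (v ++ [z]))).trace + (F z a * wordProd A v).trace =
      (insertSum A (fun s => C s - B s) (a :: (v ++ [z]))).trace := by
  have h₁ : (A z * C a * wordProd A v).trace = (C a * wordProd A (v ++ [z])).trace := by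
    rw [mul_assoc, Matrix.trace_mul_comm]
    simp [mul_assoc]
  have h₂ : (B z * A a * wordProd A v).trace = (wordProd A (a :: v) * B z).trace := by
    rw [mul_assoc, Matrix.trace_mul_comm]
    simp
  rw [pairSum_of_telescoping hF, hF, sub_mul, insertSum_sub, Matrix.trace_sub, Matrix.trace_sub,
    Matrix.trace_sub, h₁, h₂, ← List.cons_append, insertSum_append A B (a :: v) [z],
    List.cons_append, insertSum.eq_2 A C]
  simp only [Matrix.trace_add, insertSum_singleton, wordProd_cons, wordProd_nil, mul_one]
  ring

lemma WordSeparating.mono [Fintype ι] {A C : ι → Matrix n n ℂ} (hC : ∑ s, A s * C s = 1)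
    {k k' : ℕ} (h : WordSeparating A k) (hk : k ≤ k') : WordSeparating A k' := by
  induction k', hk using Nat.le_induction with
  | base => exact h
  | succ m _ ih =>
    intro X hX
    have hz : ∀ s, X * A s = 0 := fun s => ih _ fun l hl => by
      simpa [mul_assoc] using hX (s :: l) (by simp [hl])
    calc X = X * ∑ s, A s * C s := by rw [hC, mul_one]
      _ = 0 := by simp [Finset.mul_sum, ← mul_assoc, hz]

lemma WordSeparating.exists_leftInverse {A : ι → Matrix n n ℂ} {k : ℕ} (h : WordSeparating A k) :
    ∃ κ : ({l : List ι // l.length = k} → ℂ) →ₗ[ℂ] Matrix n n ℂ,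
      ∀ X : Matrix n n ℂ, κ (fun l => (X * wordProd A l.1).trace) = X := by
  let Γ : Matrix n n ℂ →ₗ[ℂ] ({l : List ι // l.length = k} → ℂ) :=
    LinearMap.pi fun l => Matrix.traceLinearMap n ℂ ℂ ∘ₗ LinearMap.mulRight ℂ (wordProd A l.1)
  have hΓ : LinearMap.ker Γ = ⊥ := by
    rw [LinearMap.ker_eq_bot']
    intro X hX
    exact h X fun l hl => congrFun hX ⟨l, hl⟩
  obtain ⟨κ, hκ⟩ := Γ.exists_leftInverse_of_injective hΓ
  exact ⟨κ, fun X => LinearMap.congr_fun hκ X⟩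

/-- Linear maps agreeing on the products along words of a separating length are equal. -/
lemma WordSeparating.linearMap_ext {A : ι → Matrix n n ℂ} {k : ℕ} (h : WordSeparating A k)
    {f g : Matrix n n ℂ →ₗ[ℂ] Matrix n n ℂ}
    (hfg : ∀ l : List ι, l.length = k → f (wordProd A l) = g (wordProd A l)) : f = g := by
  have hx : ∀ i j, ∀ Y, (f - g) Y i j =
      ((Matrix.of fun a b => (f - g) (Matrix.single b a 1) i j) * Y).trace := by
    intro i j Y
    conv_lhs => rw [Matrix.matrix_eq_sum_single Y]
    simp only [map_sum, Matrix.sum_apply, Matrix.trace, Matrix.diag_apply, Matrix.mul_apply,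
      Matrix.of_apply]
    rw [Finset.sum_comm]
    refine Finset.sum_congr rfl fun b _ => Finset.sum_congr rfl fun a _ => ?_
    have : Matrix.single a b (Y a b) = Y a b • Matrix.single a b (1 : ℂ) := by simp
    rw [this, map_smul, Matrix.smul_apply, smul_eq_mul, mul_comm]
  rw [← sub_eq_zero]
  refine LinearMap.ext fun Y => Matrix.ext fun i j => ?_
  rw [hx i j, h (Matrix.of fun a b => (f - g) (Matrix.single b a 1) i j) fun l hl => ?_]
  · simp
  · rw [← hx, LinearMap.sub_apply, hfg l hl, sub_self]; rfl

/-- Every derivation of a full matrix algebra is inner. -/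
lemma exists_commutator_of_derivation (δ : Matrix n n ℂ →ₗ[ℂ] Matrix n n ℂ)
    (hδ : ∀ X Y, δ (X * Y) = δ X * Y + X * δ Y) :
    ∃ K : Matrix n n ℂ, ∀ X, δ X = K * X - X * K := by
  rcases isEmpty_or_nonempty n with hn | ⟨⟨o⟩⟩
  · exact ⟨0, fun X => Subsingleton.elim _ _⟩
  refine ⟨∑ i, δ (Matrix.single i o 1) * Matrix.single o i 1, fun X => ?_⟩
  have hone : ∑ j : n, Matrix.single j o (1 : ℂ) * Matrix.single o j 1 = 1 := by
    simp only [Matrix.single_mul_single_same, mul_one]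
    ext i j
    simp [Matrix.sum_apply, Matrix.single_apply, Matrix.one_apply, ite_and]
  have hl : ∀ i, Matrix.single o i 1 * X = ∑ j, X i j • Matrix.single o j (1 : ℂ) := by
    intro i
    ext a b
    simp [Matrix.sum_apply, Matrix.mul_apply, Matrix.single_apply, ite_and]
  have hr : ∀ j, X * Matrix.single j o 1 = ∑ i, X i j • Matrix.single i o (1 : ℂ) := by
    intro i
    ext a b
    simp [Matrix.sum_apply, Matrix.mul_apply, Matrix.single_apply, ite_and]
  have hKX : (∑ i, δ (Matrix.single i o 1) * Matrix.single o i 1) * X =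
      ∑ j, δ (X * Matrix.single j o 1) * Matrix.single o j 1 := by
    simp only [hr, map_sum, map_smul, Finset.sum_mul, mul_assoc, hl, Finset.mul_sum,
      smul_mul_assoc, mul_smul_comm]
    exact Finset.sum_comm
  rw [hKX]
  simp only [hδ, add_mul, Finset.sum_add_distrib, mul_assoc, ← Finset.mul_sum, hone]
  noncomm_ring

lemma insertSum_central_add_commutator {A E : ι → Matrix n n ℂ} {P K : Matrix n n ℂ}
    (hP : ∀ X, P * X = X * P) (hE : ∀ s, E s = P * A s + (K * A s - A s * K)) (l : List ι) :
    insertSum A E l =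
      (l.length : ℂ) • (P * wordProd A l) + (K * wordProd A l - wordProd A l * K) := by
  induction l with
  | nil => simp [insertSum]
  | cons s l ih =>
    have h₁ : A s * (P * wordProd A l) = P * (A s * wordProd A l) := by
      rw [← mul_assoc, ← hP, mul_assoc]
    rw [insertSum, ih, hE, mul_add, mul_smul_comm, h₁, wordProd_cons, List.length_cons]
    push_cast
    rw [add_smul, one_smul]
    noncomm_ring

/-- One step of extending a family of maps compatible with concatenation to shorter words. -/
lemma exists_shorter_extension [Fintype ι] {A C W E : ι → Matrix n n ℂ}
    (hC : ∑ s, A s * C s = 1) (hW : ∑ s, W s * A s = 1)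
    {f g : Matrix n n ℂ → Matrix n n ℂ}
    (hl : ∀ s X, f (A s * X) = E s * X + A s * g X)
    (hr : ∀ s X, f (X * A s) = g X * A s + X * E s) :
    ∃ k : Matrix n n ℂ → Matrix n n ℂ,
      (∀ s X, g (A s * X) = E s * X + A s * k X) ∧
      ∀ s X, g (X * A s) = k X * A s + X * E s := by
  have key : ∀ s t X, (g (A s * X) - E s * X) * A t = A s * (g (X * A t) - X * E t) := by
    intro s t X
    have h₁ := hl s (X * A t)
    have h₂ := hr t (A s * X)
    rw [mul_assoc, h₁] at h₂
    rw [sub_mul, mul_sub, sub_eq_sub_iff_add_eq_add, ← mul_assoc (A s) X, ← h₂]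
    noncomm_ring
  have hleft : ∀ s X, g (A s * X) - E s * X =
      A s * ∑ t, (g (X * A t) - X * E t) * C t := by
    intro s X
    calc _ = (g (A s * X) - E s * X) * ∑ t, A t * C t := by rw [hC, mul_one]
      _ = _ := by simp only [Finset.mul_sum, ← mul_assoc, key]
  refine ⟨fun X => ∑ t, (g (X * A t) - X * E t) * C t,
    fun s X => by rw [← hleft]; abel, fun t X => ?_⟩
  have hcancel : ∀ P Q : Matrix n n ℂ, (∀ s, A s * P = A s * Q) → P = Q := by
    intro P Q h
    calc P = (∑ s, W s * A s) * P := by rw [hW, one_mul]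
      _ = (∑ s, W s * A s) * Q := by simp only [Finset.sum_mul, mul_assoc, h]
      _ = Q := by rw [hW, one_mul]
  rw [← sub_eq_iff_eq_add]
  refine hcancel _ _ fun s => ?_
  rw [← key, hleft, mul_assoc]

/-- A single-site insertion whose cyclic sum vanishes on a sufficiently long chain is a
commutator. -/
lemma exists_commutator_of_trace_insertSum_eq_zero [Fintype ι] {A C W E : ι → Matrix n n ℂ}
    (hC : ∑ s, A s * C s = 1) (hW : ∑ s, W s * A s = 1) {L N : ℕ} (hA : WordSeparating A L)
    (hN : 2 * L + 1 ≤ N) (h : ∀ l : List ι, l.length = N → (insertSum A E l).trace = 0) :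
    ∃ K : Matrix n n ℂ, ∀ s, E s = K * A s - A s * K := by
  have window : ∀ m, L + m ≤ N → ∃ Λ : Matrix n n ℂ →ₗ[ℂ] Matrix n n ℂ,
      ∀ u : List ι, u.length = m → Λ (wordProd A u) = insertSum A E u := by
    intro m hm
    obtain ⟨κ, hκ⟩ := (hA.mono hC (show L ≤ N - m by omega)).exists_leftInverse
    refine ⟨κ ∘ₗ LinearMap.pi fun w => -(Matrix.traceLinearMap n ℂ ℂ ∘ₗ
      LinearMap.mulRight ℂ (insertSum A E w.1)), fun u hu => ?_⟩
    rw [← hκ (insertSum A E u), LinearMap.comp_apply]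
    congr 1
    funext w
    have := h (u ++ w.1) (by simp [hu, w.2]; omega)
    rw [insertSum_append, Matrix.trace_add] at this
    simpa using (eq_neg_of_add_eq_zero_left this).symm
  obtain ⟨Λ, hΛ⟩ := window L (by omega)
  obtain ⟨Λ', hΛ'⟩ := window (L + 1) (by omega)
  have hl : ∀ s X, Λ' (A s * X) = E s * X + A s * Λ X := by
    intro s
    refine LinearMap.congr_fun (f := Λ' ∘ₗ LinearMap.mulLeft ℂ (A s))
      (g := LinearMap.mulLeft ℂ (E s) + LinearMap.mulLeft ℂ (A s) ∘ₗ Λ)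
      (hA.linearMap_ext fun u hu => ?_)
    simpa [hΛ u hu, insertSum] using hΛ' (s :: u) (by simp [hu])
  have hr : ∀ s X, Λ' (X * A s) = Λ X * A s + X * E s := by
    intro s
    refine LinearMap.congr_fun (f := Λ' ∘ₗ LinearMap.mulRight ℂ (A s))
      (g := LinearMap.mulRight ℂ (A s) ∘ₗ Λ + LinearMap.mulRight ℂ (E s))
      (hA.linearMap_ext fun u hu => ?_)
    simpa [hΛ u hu, insertSum_append] using hΛ' (u ++ [s]) (by simp [hu])
  have descent : ∀ k, ∃ f g : Matrix n n ℂ → Matrix n n ℂ,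
      (∀ s X, f (A s * X) = E s * X + A s * g X) ∧
      (∀ s X, f (X * A s) = g X * A s + X * E s) ∧
      (∀ u : List ι, u.length = k → ∀ X,
        Λ' (wordProd A u * X) = insertSum A E u * X + wordProd A u * f X) ∧
      (∀ u : List ι, u.length = k → ∀ X,
        Λ' (X * wordProd A u) = f X * wordProd A u + X * insertSum A E u) ∧
      (∀ u : List ι, u.length = k → ∀ X,
        Λ (wordProd A u * X) = insertSum A E u * X + wordProd A u * g X) ∧
      ∀ u : List ι, u.length = k → ∀ X,
        Λ (X * wordProd A u) = g X * wordProd A u + X * insertSum A E u := by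
    intro k
    induction k with
    | zero =>
      refine ⟨Λ', Λ, hl, hr, ?_, ?_, ?_, ?_⟩ <;>
      · intro u hu X
        obtain rfl := List.length_eq_zero_iff.1 hu
        simp [insertSum]
    | succ k ih =>
      obtain ⟨f, g, h₁, h₂, h₃, h₄, h₅, h₆⟩ := ih
      obtain ⟨e, h₇, h₈⟩ := exists_shorter_extension hC hW h₁ h₂
      have left : ∀ (Θ p q : Matrix n n ℂ → Matrix n n ℂ),
          (∀ s X, p (A s * X) = E s * X + A s * q X) →
          (∀ u : List ι, u.length = k → ∀ X,
            Θ (wordProd A u * X) = insertSum A E u * X + wordProd A u * p X) →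
          ∀ u : List ι, u.length = k + 1 → ∀ X,
            Θ (wordProd A u * X) = insertSum A E u * X + wordProd A u * q X := by
        intro Θ p q hp hΘ u hu X
        obtain ⟨v, s, rfl⟩ := u.eq_nil_or_concat'.resolve_left (by rintro rfl; simp at hu)
        rw [wordProd_append, mul_assoc, hΘ v (by simpa using hu), insertSum_append]
        simp only [wordProd_cons, wordProd_nil, mul_one, insertSum_singleton, hp]
        noncomm_ring
      have right : ∀ (Θ p q : Matrix n n ℂ → Matrix n n ℂ),
          (∀ s X, p (X * A s) = q X * A s + X * E s) →
          (∀ u : List ι, u.length = k → ∀ X,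
            Θ (X * wordProd A u) = p X * wordProd A u + X * insertSum A E u) →
          ∀ u : List ι, u.length = k + 1 → ∀ X,
            Θ (X * wordProd A u) = q X * wordProd A u + X * insertSum A E u := by
        intro Θ p q hp hΘ u hu X
        obtain ⟨s, v, rfl⟩ := List.exists_cons_of_length_eq_add_one hu
        rw [wordProd_cons, ← mul_assoc, hΘ v (by simpa using hu), hp, insertSum]
        noncomm_ring
      exact ⟨g, e, h₇, h₈, left Λ' f g h₁ h₃, right Λ' f g h₂ h₄, left Λ g e h₇ h₅,
        right Λ g e h₈ h₆⟩
  obtain ⟨f, g, h₁, -, h₃, h₄, h₅, h₆⟩ := descent L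
  have e₁ : ∀ X Y, Λ (Y * X) = Λ Y * X + Y * g X := by
    intro X
    refine LinearMap.congr_fun (f := Λ ∘ₗ LinearMap.mulRight ℂ X)
      (g := LinearMap.mulRight ℂ X ∘ₗ Λ + LinearMap.mulRight ℂ (g X))
      (hA.linearMap_ext fun u hu => ?_)
    simp [hΛ u hu, h₅ u hu]
  have e₂ : ∀ X Y, Λ (X * Y) = g X * Y + X * Λ Y := by
    intro X
    refine LinearMap.congr_fun (f := Λ ∘ₗ LinearMap.mulLeft ℂ X)
      (g := LinearMap.mulLeft ℂ (g X) + LinearMap.mulLeft ℂ X ∘ₗ Λ)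
      (hA.linearMap_ext fun u hu => ?_)
    simp [hΛ u hu, h₆ u hu]
  have e₃ : ∀ X Y, Λ' (Y * X) = Λ Y * X + Y * f X := by
    intro X
    refine LinearMap.congr_fun (f := Λ' ∘ₗ LinearMap.mulRight ℂ X)
      (g := LinearMap.mulRight ℂ X ∘ₗ Λ + LinearMap.mulRight ℂ (f X))
      (hA.linearMap_ext fun u hu => ?_)
    simp [hΛ u hu, h₃ u hu]
  have e₄ : ∀ X Y, Λ' (X * Y) = f X * Y + X * Λ Y := by
    intro X
    refine LinearMap.congr_fun (f := Λ' ∘ₗ LinearMap.mulLeft ℂ X)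
      (g := LinearMap.mulLeft ℂ (f X) + LinearMap.mulLeft ℂ X ∘ₗ Λ)
      (hA.linearMap_ext fun u hu => ?_)
    simp [hΛ u hu, h₄ u hu]
  have hgl : ∀ X, g X = Λ X - Λ 1 * X := fun X => by
    have := e₁ X 1
    simp only [one_mul] at this
    rw [this]; abel
  have hg : ∀ X Y, g (X * Y) = g X * Y + X * g Y := fun X Y => by
    rw [hgl (X * Y), e₁, hgl X]
    noncomm_ring
  have hfg : ∀ X Y, Y * (f X - g X) = (f Y - g Y) * X := fun X Y => by
    have h₇ := (e₃ X Y).symm.trans (e₄ Y X)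
    have h₈ := (e₁ X Y).symm.trans (e₂ Y X)
    calc Y * (f X - g X) = (Λ Y * X + Y * f X) - (Λ Y * X + Y * g X) := by noncomm_ring
      _ = (f Y - g Y) * X := by rw [h₇, h₈]; noncomm_ring
  have hfg₁ : ∀ X, f X - g X = (f 1 - g 1) * X := fun X => by simpa using hfg X 1
  have hcentral : ∀ X, (f 1 - g 1) * X = X * (f 1 - g 1) := fun X => by
    rw [← hfg₁, hfg 1 X, mul_one]
  obtain ⟨K, hK⟩ := exists_commutator_of_derivation (Λ - LinearMap.mulLeft ℂ (Λ 1))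
    fun X Y => by simpa [hgl] using hg X Y
  have hgK : ∀ X, g X = K * X - X * K := fun X => by rw [← hK X, hgl]; rfl
  have hE : ∀ s, E s = (f 1 - g 1) * A s + (K * A s - A s * K) := fun s => by
    have h₇ := h₁ s 1
    have h₈ : g 1 = 0 := by rw [hgl]; simp
    rw [h₈] at h₇
    rw [← hfg₁, ← hgK]
    simpa using h₇.symm
  have hzero : f 1 - g 1 = 0 := by
    refine hA.mono hC (show L ≤ N by omega) _ fun l hl => ?_
    have h₇ := h l hl
    rw [insertSum_central_add_commutator hcentral hE, hl, Matrix.trace_add, Matrix.trace_sub,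
      Matrix.trace_mul_comm K, sub_self, add_zero, Matrix.trace_smul, smul_eq_mul] at h₇
    exact (mul_eq_zero.1 h₇).resolve_left (Nat.cast_ne_zero.2 (by omega))
  exact ⟨K, fun s => by rw [hE, hzero]; simp⟩

/-- On a window of the chain, the sum over adjacent pairs depends on the products along the words
missing the first, respectively the last, letter of the window. -/
lemma exists_pairSum_window {A : ι → Matrix n n ℂ} {F : ι → ι → Matrix n n ℂ} {m k N : ℕ}
    (hA : WordSeparating A (k + 1)) (hN : m + 2 + (k + 1) = N)
    (h : ∀ a v z, (a :: (v ++ [z])).length = N →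
      (pairSum A F (a :: (v ++ [z]))).trace + (F z a * wordProd A v).trace = 0) :
    ∃ Φ Ψ : ι → Matrix n n ℂ →ₗ[ℂ] Matrix n n ℂ, ∀ s v t, v.length = m →
      pairSum A F (s :: (v ++ [t])) = Φ s (wordProd A v * A t) + Ψ t (A s * wordProd A v) := by
  obtain ⟨κ, hκ⟩ := hA.exists_leftInverse
  have hne : ∀ w : {l : List ι // l.length = k + 1}, w.1 ≠ [] := fun w hw => by
    simpa [hw] using w.2
  refine ⟨fun s => κ ∘ₗ LinearMap.pi fun w => -(Matrix.traceLinearMap n ℂ ℂ ∘ₗ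
      LinearMap.mulLeft ℂ (F (w.1.getLast (hne w)) s) ∘ₗ
      LinearMap.mulRight ℂ (wordProd A w.1.dropLast)),
    fun t => κ ∘ₗ LinearMap.pi fun w => -(Matrix.traceLinearMap n ℂ ℂ ∘ₗ LinearMap.mulRight ℂ
      (F t (w.1.head (hne w)) * wordProd A w.1.tail + A t * pairSum A F w.1)),
    fun s v t hv => ?_⟩
  rw [← hκ (pairSum A F (s :: (v ++ [t]))), LinearMap.comp_apply, LinearMap.comp_apply, ← map_add]
  congr 1
  funext w
  have h₁ := h s (v ++ [t] ++ w.1.dropLast) (w.1.getLast (hne w)) (by simp [hv, w.2]; omega)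
  have h₂ := pairSum_append A F (s :: v) w.1.tail t (w.1.head (hne w))
  rw [List.append_assoc, List.dropLast_append_getLast] at h₁
  rw [List.cons_head_tail, List.append_assoc, List.cons_append, ← List.append_assoc] at h₂
  rw [h₂] at h₁
  simp only [wordProd_append, wordProd_cons, wordProd_nil, mul_one, Matrix.trace_add,
    List.cons_append] at h₁
  simp only [LinearMap.pi_apply, LinearMap.neg_apply, LinearMap.comp_apply, Pi.add_apply,
    LinearMap.mulLeft_apply, LinearMap.mulRight_apply, Matrix.traceLinearMap_apply, mul_add,
    Matrix.trace_add]
  simp only [mul_assoc] at h₁ ⊢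
  linear_combination h₁

/-- If the cyclic sum over adjacent pairs vanishes, `F` is a difference of one-site insertions. -/
lemma exists_two_site_decomposition [Fintype ι] {A C W : ι → Matrix n n ℂ}
    {F : ι → ι → Matrix n n ℂ} (hC : ∑ s, A s * C s = 1) (hW : ∑ s, W s * A s = 1) {L N : ℕ}
    (hA : WordSeparating A L) (hN : 2 * L + 3 < N)
    (h : ∀ a v z, (a :: (v ++ [z])).length = N →
      (pairSum A F (a :: (v ++ [z]))).trace + (F z a * wordProd A v).trace = 0) :
    ∃ B G : ι → Matrix n n ℂ, ∀ a b, F a b = A a * G b - B a * A b := by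
  obtain ⟨Φ, Ψ, h₁⟩ := exists_pairSum_window (m := L + 1) (k := N - L - 4)
    (hA.mono hC (by omega)) (by omega) h
  obtain ⟨Φ', Ψ', h₂⟩ := exists_pairSum_window (m := L) (k := N - L - 3)
    (hA.mono hC (by omega)) (by omega) h
  have hrec : ∀ a b t Z, Φ a (A b * Z * A t) + Ψ t (A a * (A b * Z)) =
      F a b * (Z * A t) + A a * (Φ' b (Z * A t) + Ψ' t (A b * Z)) := by
    intro a b t
    refine LinearMap.congr_fun
      (f := Φ a ∘ₗ LinearMap.mulRight ℂ (A t) ∘ₗ LinearMap.mulLeft ℂ (A b) +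
        Ψ t ∘ₗ LinearMap.mulLeft ℂ (A a) ∘ₗ LinearMap.mulLeft ℂ (A b))
      (g := LinearMap.mulLeft ℂ (F a b) ∘ₗ LinearMap.mulRight ℂ (A t) +
        LinearMap.mulLeft ℂ (A a) ∘ₗ (Φ' b ∘ₗ LinearMap.mulRight ℂ (A t) +
          Ψ' t ∘ₗ LinearMap.mulLeft ℂ (A b)))
      (hA.linearMap_ext fun v hv => ?_)
    have h₃ := h₁ a (b :: v) t (by simp [hv])
    rw [List.cons_append, pairSum, h₂ b v t hv] at h₃
    simpa using h₃.symm
  let φ : ι → Matrix n n ℂ →ₗ[ℂ] Matrix n n ℂ := fun a => Φ a + ∑ t, Ψ t ∘ₗ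
    LinearMap.mulLeft ℂ (A a) ∘ₗ LinearMap.mulRight ℂ (W t)
  let φ' : ι → Matrix n n ℂ →ₗ[ℂ] Matrix n n ℂ := fun a => Φ' a + ∑ t, Ψ' t ∘ₗ
    LinearMap.mulLeft ℂ (A a) ∘ₗ LinearMap.mulRight ℂ (W t)
  have hφ : ∀ a b Z, φ a (A b * Z) = F a b * Z + A a * φ' b Z := by
    intro a b Z
    have hZ : ∑ t, Z * W t * A t = Z := by simp only [mul_assoc, ← Finset.mul_sum, hW, mul_one]
    have h₃ := Finset.sum_congr rfl fun t (_ : t ∈ Finset.univ) => hrec a b t (Z * W t)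
    simp only [Finset.sum_add_distrib, ← Finset.mul_sum, mul_assoc (A b), ← map_sum, hZ] at h₃
    simpa [φ, φ', mul_assoc] using h₃
  have hφ₁ : ∀ a Z, φ a Z = (∑ b, F a b * C b) * Z + A a * ∑ b, φ' b (C b * Z) := by
    intro a Z
    calc φ a Z = φ a (∑ b, A b * (C b * Z)) := by
          simp only [← mul_assoc, ← Finset.sum_mul, hC, one_mul]
      _ = _ := by simp only [map_sum, hφ, Finset.sum_add_distrib, Finset.sum_mul, Finset.mul_sum,
          mul_assoc]
  refine ⟨fun a => -∑ b, F a b * C b, fun b => (∑ c, φ' c (C c * A b)) - φ' b 1, fun a b => ?_⟩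
  have h₄ := hφ a b 1
  rw [mul_one, mul_one, hφ₁] at h₄
  rw [← sub_eq_iff_eq_add] at h₄
  rw [← h₄]
  noncomm_ring

/-- The cyclic sum over adjacent pairs vanishes on a sufficiently long chain if and only if `F`
telescopes. -/
lemma trace_cyclic_pairSum_eq_zero_iff [Fintype ι] {A C W : ι → Matrix n n ℂ}
    {F : ι → ι → Matrix n n ℂ} (hC : ∑ s, A s * C s = 1) (hW : ∑ s, W s * A s = 1) {L N : ℕ}
    (hA : WordSeparating A L) (hN : 2 * L + 3 < N) :
    (∀ a v z, (a :: (v ++ [z])).length = N →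
      (pairSum A F (a :: (v ++ [z]))).trace + (F z a * wordProd A v).trace = 0) ↔
    ∃ B : ι → Matrix n n ℂ, ∀ a b, F a b = A a * B b - B a * A b := by
  constructor
  · intro h
    obtain ⟨B, G, hF⟩ := exists_two_site_decomposition hC hW hA hN h
    obtain ⟨K, hK⟩ := exists_commutator_of_trace_insertSum_eq_zero (E := fun s => G s - B s)
      (N := N) hC hW hA (by omega) fun l hl => by
        obtain ⟨a, l, rfl⟩ := List.exists_cons_of_length_pos (l := l) (by omega)
        obtain ⟨v, z, rfl⟩ := l.eq_nil_or_concat'.resolve_left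
          (by rintro rfl; simp at hl; omega)
        rw [← trace_cyclic_pairSum_of_telescoping hF, h a v z hl]
    refine ⟨fun s => B s - A s * K, fun a b => ?_⟩
    have hG : G b = B b + (K * A b - A b * K) := by rw [← hK b]; abel
    rw [hF, hG]
    noncomm_ring
  · rintro ⟨B, hF⟩ a v z -
    have h₀ : ∀ l, insertSum A (fun s => B s - B s) l = 0 := fun l => by
      rw [insertSum_sub, sub_self]
    rw [trace_cyclic_pairSum_of_telescoping hF, h₀, Matrix.trace_zero]

/-- Trace of the ordered product along a word whose first two factors are replaced by `F`. -/
def pairTrace (A : ι → Matrix n n ℂ) (F : ι → ι → Matrix n n ℂ) : List ι → ℂ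
  | a :: b :: l => (F a b * wordProd A l).trace
  | _ => 0

lemma pairTrace_sub (A : ι → Matrix n n ℂ) (F G : ι → ι → Matrix n n ℂ) (l : List ι) :
    pairTrace A (fun a b => F a b - G a b) l = pairTrace A F l - pairTrace A G l := by
  rcases l with - | ⟨a, - | ⟨b, l⟩⟩ <;> simp [pairTrace, sub_mul]

lemma sum_pairTrace_rotate (A : ι → Matrix n n ℂ) (F : ι → ι → Matrix n n ℂ) (a : ι)
    (q p : List ι) :
    ∑ k ∈ Finset.range q.length, pairTrace A F ((a :: q ++ p).rotate k) =
      (pairSum A F (a :: q) * wordProd A p).trace := by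
  induction q generalizing a p with
  | nil => simp [pairSum]
  | cons b r ih =>
    rw [List.length_cons, Finset.sum_range_succ']
    have h : ∀ k, (a :: b :: r ++ p).rotate (k + 1) = (b :: r ++ (p ++ [a])).rotate k := by
      intro k
      simp
    simp only [h, ih, List.rotate_zero]
    rw [List.cons_append, List.cons_append, pairTrace, pairSum, add_mul, Matrix.trace_add,
      wordProd_append, wordProd_append, wordProd_cons, wordProd_nil, mul_one, mul_assoc (A a),
      Matrix.trace_mul_comm (A a), add_comm]
    simp only [mul_assoc]

lemma sum_pairTrace_rotate_eq (A : ι → Matrix n n ℂ) (F : ι → ι → Matrix n n ℂ) (a z : ι)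
    (v : List ι) :
    ∑ k ∈ Finset.range (a :: (v ++ [z])).length, pairTrace A F ((a :: (v ++ [z])).rotate k) =
      (pairSum A F (a :: (v ++ [z]))).trace + (F z a * wordProd A v).trace := by
  have h₁ := sum_pairTrace_rotate A F a (v ++ [z]) []
  have h₂ : (a :: (v ++ [z])).rotate (v ++ [z]).length = z :: a :: v := by
    have : (v ++ [z]).length = (a :: v).length := by simp
    rw [this, ← List.cons_append, List.rotate_append_length_eq]
    rfl
  rw [List.append_nil, wordProd_nil, mul_one] at h₁
  rw [List.length_cons, Finset.sum_range_succ, h₁, h₂, pairTrace]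

end MatrixWords

section Chain

lemma cyc_eq_add {N : ℕ} (a t : Fin N) : cyc a t.val = a + t :=
  Fin.ext (Fin.val_add a t).symm

lemma ofFn_rotate {α : Type*} {N : ℕ} (f : Fin N → α) (a : Fin N) :
    (List.ofFn f).rotate a = List.ofFn fun t => f (a + t) := by
  refine List.ext_getElem (by simp) fun k h₁ h₂ => ?_
  simp only [List.getElem_rotate, List.getElem_ofFn, List.length_ofFn]
  congr 1
  ext
  simp [Fin.val_add, add_comm]

lemma trace_prod_rotate {D : ℕ} (l : List (Matrix (Fin D) (Fin D) ℂ)) (k : ℕ) :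
    (l.rotate k).prod.trace = l.prod.trace := by
  induction k generalizing l with
  | zero => simp
  | succ k ih =>
    cases l with
    | nil => simp
    | cons a l => rw [List.rotate_cons_succ, ih, List.prod_append, List.prod_singleton,
        Matrix.trace_mul_comm, List.prod_cons]

/-- Two-site tensor obtained by acting with `h` on the upper indices of two MPO tensors. -/
def actUpper {d D : ℕ} (h : Matrix (Fin 2 → Fin d) (Fin 2 → Fin d) ℂ)
    (T : Fin d → Fin d → Matrix (Fin D) (Fin D) ℂ) (p q : Fin d × Fin d) :
    Matrix (Fin D) (Fin D) ℂ :=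
  ∑ k₁ : Fin d, ∑ k₂ : Fin d, h ![p.1, q.1] ![k₁, k₂] • (T k₁ p.2 * T k₂ q.2)

lemma localOp_mul_mpo_apply {d D N : ℕ} (hN : 2 ≤ N)
    (h : Matrix (Fin 2 → Fin d) (Fin 2 → Fin d) ℂ)
    (T : Fin d → Fin d → Matrix (Fin D) (Fin D) ℂ) (a : Fin N) (x y : Fin N → Fin d) :
    (localOp h a * mpo (N := N) T) x y =
      pairTrace (fun p : Fin d × Fin d => T p.1 p.2) (actUpper h T)
        ((List.ofFn fun i => (x i, y i)).rotate a) := by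
  obtain ⟨M, rfl⟩ : ∃ M, N = M + 2 := ⟨N - 2, by omega⟩
  have hlocal : ∀ z : Fin (M + 2) → Fin d, localOp h a x (fun m => z (m - a)) =
      h ![x a, x (a + 1)] ![z 0, z 1] *
        if (fun t : Fin M => x (a + t.succ.succ)) = fun t => z t.succ.succ then 1 else 0 := by
    intro z
    have h₀ : cyc a 0 = a := by simpa using cyc_eq_add a 0
    have h₁ : cyc a 1 = a + 1 := by simpa using cyc_eq_add a 1
    have hx : ∀ w : Fin (M + 2) → Fin d,
        (fun t : Fin 2 => w (cyc a t.val)) = ![w a, w (a + 1)] := by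
      intro w
      funext t
      fin_cases t <;> simp [h₀, h₁]
    rw [localOp, Matrix.of_apply, hx x, hx fun m => z (m - a)]
    simp only [sub_self, add_sub_cancel_left]
    congr 2
    simp only [Fin.forall_fin_two, Fin.val_zero, Fin.val_one, h₀, h₁, funext_iff, eq_iff_iff]
    rw [← (Equiv.addLeft a).forall_congr_right]
    simp only [Equiv.coe_addLeft, add_sub_cancel_left, Fin.forall_fin_succ (n := M + 1),
      Fin.forall_fin_succ (n := M)]
    simp [Fin.ext_iff]
  have hmpo : ∀ z : Fin (M + 2) → Fin d, mpo T (fun m => z (m - a)) y =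
      (List.ofFn fun t => T (z t) (y (a + t))).prod.trace := by
    intro z
    rw [mpo, Matrix.of_apply, ← trace_prod_rotate _ a, ofFn_rotate]
    simp
  have hsum : (localOp h a * mpo (N := M + 2) T) x y =
      ∑ z : Fin (M + 2) → Fin d, localOp h a x (fun m => z (m - a)) *
        mpo T (fun m => z (m - a)) y := by
    rw [Matrix.mul_apply]
    exact (((Equiv.subRight a).arrowCongr (Equiv.refl (Fin d))).symm.sum_comp
      fun z => localOp h a x z * mpo T z y).symm
  rw [hsum, ← (Fin.consEquiv fun _ => Fin d).sum_comp, Fintype.sum_prod_type]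
  simp only [← (Fin.consEquiv fun _ : Fin (M + 1) => Fin d).sum_comp, Fintype.sum_prod_type]
  simp only [hlocal, hmpo, Fin.consEquiv_apply]
  rw [ofFn_rotate]
  simp [List.ofFn_succ, pairTrace, actUpper, Finset.sum_mul, Matrix.trace_sum, wordProd, mul_assoc,
    Function.comp_def]

lemma pairTrace_map {ι κ n : Type*} [Fintype n] [DecidableEq n] (A : κ → Matrix n n ℂ)
    (F : κ → κ → Matrix n n ℂ) (f : ι → κ) (l : List ι) :
    pairTrace A F (l.map f) = pairTrace (fun a => A (f a)) (fun a b => F (f a) (f b)) l := by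
  rcases l with - | ⟨a, - | ⟨b, l⟩⟩ <;> simp [pairTrace, wordProd, Function.comp_def]

lemma transpose_localOp {d k N : ℕ} (o : Matrix (Fin k → Fin d) (Fin k → Fin d) ℂ) (a : Fin N) :
    (localOp o a)ᵀ = localOp oᵀ a := by
  ext x y
  simp only [localOp, Matrix.transpose_apply, Matrix.of_apply, eq_comm]

lemma transpose_mpo {d D N : ℕ} (T : Fin d → Fin d → Matrix (Fin D) (Fin D) ℂ) :
    (mpo (N := N) T)ᵀ = mpo fun i j => T j i := rfl

lemma mpo_mul_localOp_apply {d D N : ℕ} (hN : 2 ≤ N)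
    (h : Matrix (Fin 2 → Fin d) (Fin 2 → Fin d) ℂ)
    (T : Fin d → Fin d → Matrix (Fin D) (Fin D) ℂ) (a : Fin N) (x y : Fin N → Fin d) :
    (mpo (N := N) T * localOp h a) x y =
      pairTrace (fun p : Fin d × Fin d => T p.1 p.2)
        (fun p q => actUpper hᵀ (fun i j => T j i) p.swap q.swap)
        ((List.ofFn fun i => (x i, y i)).rotate a) := by
  have h₁ : (List.ofFn fun i => (y i, x i)).rotate a =
      ((List.ofFn fun i => (x i, y i)).rotate a).map Prod.swap := by
    rw [List.map_rotate, List.map_ofFn]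
    rfl
  rw [← Matrix.transpose_apply (mpo T * localOp h a), Matrix.transpose_mul, transpose_localOp,
    transpose_mpo, localOp_mul_mpo_apply hN, h₁, pairTrace_map]
  rfl

/-- Two-site tensor of the commutator of a two-site operator with an MPO. -/
def commTensor {d D : ℕ} (h : Matrix (Fin 2 → Fin d) (Fin 2 → Fin d) ℂ)
    (T : Fin d → Fin d → Matrix (Fin D) (Fin D) ℂ) (p q : Fin d × Fin d) :
    Matrix (Fin D) (Fin D) ℂ :=
  actUpper h T p q - actUpper hᵀ (fun i j => T j i) p.swap q.swap

lemma commutator_mpo_apply {d D N : ℕ} (hN : 2 ≤ N)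
    (h : Matrix (Fin 2 → Fin d) (Fin 2 → Fin d) ℂ)
    (T : Fin d → Fin d → Matrix (Fin D) (Fin D) ℂ) (x y : Fin N → Fin d) :
    (opSum h * mpo T - mpo T * opSum h : Matrix (Fin N → Fin d) (Fin N → Fin d) ℂ) x y =
      ∑ k ∈ Finset.range (List.ofFn fun i => (x i, y i)).length,
        pairTrace (fun p : Fin d × Fin d => T p.1 p.2) (commTensor h T)
          ((List.ofFn fun i => (x i, y i)).rotate k) := by
  rw [List.length_ofFn, ← Fin.sum_univ_eq_sum_range
    fun k => pairTrace (fun p : Fin d × Fin d => T p.1 p.2) (commTensor h T)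
      ((List.ofFn fun i => (x i, y i)).rotate k)]
  simp only [opSum, Finset.sum_mul, Finset.mul_sum, Matrix.sub_apply, Matrix.sum_apply,
    localOp_mul_mpo_apply hN, mpo_mul_localOp_apply hN, ← Finset.sum_sub_distrib,
    ← pairTrace_sub]
  rfl

lemma commute_mpo_iff {d D N : ℕ} (hN : 2 ≤ N) (h : Matrix (Fin 2 → Fin d) (Fin 2 → Fin d) ℂ)
    (T : Fin d → Fin d → Matrix (Fin D) (Fin D) ℂ) :
    opSum (N := N) h * mpo T = mpo T * opSum (N := N) h ↔
      ∀ a v z, (a :: (v ++ [z])).length = N →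
        (pairSum (fun p : Fin d × Fin d => T p.1 p.2) (commTensor h T) (a :: (v ++ [z]))).trace +
          (commTensor h T z a * wordProd (fun p : Fin d × Fin d => T p.1 p.2) v).trace = 0 := by
  simp only [← sum_pairTrace_rotate_eq]
  rw [← sub_eq_zero]
  constructor
  · intro hcomm a v z hl
    obtain ⟨s, hs⟩ : ∃ s : Fin N → Fin d × Fin d, a :: (v ++ [z]) = List.ofFn s := by
      subst hl
      exact ⟨_, (List.ofFn_get _).symm⟩
    rw [hs]
    have := commutator_mpo_apply hN h T (fun i => (s i).1) fun i => (s i).2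
    rw [hcomm] at this
    exact this.symm
  · intro hl
    ext x y
    rw [commutator_mpo_apply hN]
    have hlen : (List.ofFn fun i => (x i, y i)).length = N := by simp
    obtain ⟨a, l, hal⟩ := List.exists_cons_of_length_pos
      (l := List.ofFn fun i => (x i, y i)) (by omega)
    rw [hal] at hlen ⊢
    obtain ⟨v, z, rfl⟩ := l.eq_nil_or_concat'.resolve_left (by rintro rfl; simp at hlen; omega)
    exact hl a v z hlen

lemma InjectiveLen'.wordSeparating {ι : Type*} {D L : ℕ} {A : ι → Matrix (Fin D) (Fin D) ℂ}
    (h : InjectiveLen' A L) : WordSeparating A L := by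
  intro X hX
  refine h (funext fun i => ?_)
  have := hX (List.ofFn i) (by simp)
  simpa [wordProd, List.map_ofFn, Function.comp_def] using this

lemma TransferFixedPoints'.exists_leftInverse {ι : Type*} [Fintype ι] {D : ℕ}
    {A : ι → Matrix (Fin D) (Fin D) ℂ} {ρL ρR : Matrix (Fin D) (Fin D) ℂ}
    (h : TransferFixedPoints' A ρL ρR) :
    ∃ W : ι → Matrix (Fin D) (Fin D) ℂ, ∑ s, W s * A s = 1 := by
  refine ⟨fun s => ρL⁻¹ * ((A s)ᴴ * ρL), ?_⟩
  simp only [mul_assoc ρL⁻¹, ← Finset.mul_sum, h.2.2.1]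
  exact Matrix.nonsing_inv_mul _ ((Matrix.isUnit_iff_isUnit_det _).1 h.1.isUnit)

lemma TransferFixedPoints'.exists_rightInverse {ι : Type*} [Fintype ι] {D : ℕ}
    {A : ι → Matrix (Fin D) (Fin D) ℂ} {ρL ρR : Matrix (Fin D) (Fin D) ℂ}
    (h : TransferFixedPoints' A ρL ρR) :
    ∃ C : ι → Matrix (Fin D) (Fin D) ℂ, ∑ s, A s * C s = 1 := by
  refine ⟨fun s => ρR * (A s)ᴴ * ρR⁻¹, ?_⟩
  simp only [← mul_assoc, ← Finset.sum_mul, h.2.2.2]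
  exact Matrix.mul_nonsing_inv _ ((Matrix.isUnit_iff_isUnit_det _).1 h.2.1.isUnit)

end Chain

/-- Let the vectorized MPO tensor `T̂^{(i,j)} = T^{ij}` (an MPS
tensor with physical dimension `d²`) be injective with injectivity length `L`
and admit positive definite transfer fixed points, and let `N > 2L + 3`. Then
`[H_N, O^{MPO}_N] = 0` iff there is a family `B` with
`Σ_k h^{i_1 i_2}_{k_1 k_2} T^{k_1 j_1} T^{k_2 j_2}
 − Σ_k T^{i_1 k_1} T^{i_2 k_2} h^{k_1 k_2}_{j_1 j_2}
 = T^{i_1 j_1} B^{i_2 j_2} − B^{i_1 j_1} T^{i_2 j_2}`. -/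
theorem mpo_symmetry_iff_local
    (d D : ℕ) (hd : 1 ≤ d) (hD : 1 ≤ D)
    (T : Fin d → Fin d → Matrix (Fin D) (Fin D) ℂ)
    (L : ℕ) (hinj : InjectiveLen' (fun p : Fin d × Fin d => T p.1 p.2) L)
    (ρL ρR : Matrix (Fin D) (Fin D) ℂ)
    (hfix : TransferFixedPoints' (fun p : Fin d × Fin d => T p.1 p.2) ρL ρR)
    (h : Matrix (Fin 2 → Fin d) (Fin 2 → Fin d) ℂ)
    (N : ℕ) (hN : 2 * L + 3 < N) :
    opSum (N := N) h * mpo T = mpo T * opSum (N := N) h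
      ↔ ∃ B : Fin d → Fin d → Matrix (Fin D) (Fin D) ℂ,
          ∀ i1 i2 j1 j2 : Fin d,
            (∑ k1 : Fin d, ∑ k2 : Fin d,
                h ![i1, i2] ![k1, k2] • (T k1 j1 * T k2 j2))
              - (∑ k1 : Fin d, ∑ k2 : Fin d,
                h ![k1, k2] ![j1, j2] • (T i1 k1 * T i2 k2))
            = T i1 j1 * B i2 j2 - B i1 j1 * T i2 j2 := by
  obtain ⟨W, hW⟩ := hfix.exists_leftInverse
  obtain ⟨C, hC⟩ := hfix.exists_rightInverse
  rw [commute_mpo_iff (by omega), trace_cyclic_pairSum_eq_zero_iff hC hW hinj.wordSeparating hN]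
  constructor
  · rintro ⟨B, hB⟩
    exact ⟨fun i j => B (i, j), fun i₁ i₂ j₁ j₂ => hB (i₁, j₁) (i₂, j₂)⟩
  · rintro ⟨B, hB⟩
    exact ⟨fun p => B p.1 p.2, fun p q => hB p.1 q.1 p.2 q.2⟩
end

section
/- Let A : Fin d → Fin D → Fin D → Fin D → Fin D → ℂ be a PEPS tensor, written A^i(l, r, u, w) with virtual legs left, right, up, down. Let O be a plaquette operator on (ℂ^d)^{⊗4} with matrix elements O^{(i_1 i_2 i_3 i_4)}_{(j_1 j_2 j_3 j_4)}, where the four factors correspond to the sites (x,y), (x+1,y), (x,y+1), (x+1,y+1) of a 2×2 plaquette, and let ε₀ ∈ ℂ. For a 2×2 patch define the patch tensor P(i_1,i_2,i_3,i_4; l_1, l_3, r_2, r_4, w_1, w_2, u_3, u_4) := Σ_{h_b, h_t, v_l, v_r ∈ Fin D} A^{i_1}(l_1, h_b, v_l, w_1) A^{i_2}(h_b, r_2, v_r, w_2) A^{i_3}(l_3, h_t, u_3, v_l) A^{i_4}(h_t, r_4, u_4, v_r). Suppose there exist tensors X : Fin d → Fin d → (Fin D)^6 → ℂ and Y : Fin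 d → Fin d → (Fin D)^6 → ℂ such that for all physical indices i_1, i_2, i_3, i_4 and all external virtual indices l_1, l_3, r_2, r_4, w_1, w_2, u_3, u_4: Σ_{j_1,…,j_4} O^{(i_1 i_2 i_3 i_4)}_{(j_1 j_2 j_3 j_4)} P(j_1,…,j_4; ext) − ε₀ P(i_1,…,i_4; ext) = P_X^{bot}(i⃗; ext) − P_X^{top}(i⃗; ext) + P_Y^{left}(i⃗; ext) − P_Y^{right}(i⃗; ext), where P_X^{bot} := Σ_{h_t, v_l, v_r} X^{i_1 i_2}(l_1, r_2, v_l, w_1, v_r, w_2) A^{i_3}(l_3, h_t, u_3, v_l) A^{i_4}(h_t, r_4, u_4, v_r); P_X^{top} := Σ_{h_b, v_l, v_r} A^{i_1}(l_1, h_b, v_l, w_1) A^{i_2}(h_b, r_2, v_r, w_2) X^{i_3 i_4}(l_3, r_4, u_3, v_l, u_4, v_r); P_Y^{left} := Σ_{h_b, h_t, v_r} Y^{i_1 i_3}(l_1, h_b, w_1, l_3, h_t, u_3) A^{i_2}(h_b, r_2, v_r, w_2) A^{i_4}(h_t, r_4, u_4, v_r); P_Y^{right} := Σ_{h_b, h_t,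 v_l} A^{i_1}(l_1, h_b, v_l, w_1) A^{i_3}(l_3, h_t, u_3, v_l) Y^{i_2 i_4}(h_b, r_2, w_2, h_t, r_4, u_4). Then for all N_1, N_2 ≥ 2, the PEPS ψ on the N_1 × N_2 torus satisfies 𝒪 ψ = (N_1 N_2 ε₀) ψ, where 𝒪 := Σ_{(x,y) ∈ ℤ/N_1 × ℤ/N_2} O_{(x,y)} and O_{(x,y)} acts as O on the sites (x,y), (x+1,y), (x,y+1), (x+1,y+1). -/
open Matrix

/-- The PEPS on the `N₁ × N₂` torus associated with a PEPS tensor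
`A : Fin d → Fin D → Fin D → Fin D → Fin D → ℂ`, `A^i(l, r, u, w)`:
`ψ(i) = Σ_{H,V} Π_{(x,y)} A^{i(x,y)}(H(x−1,y), H(x,y), V(x,y), V(x,y−1))`. -/
noncomputable def peps {d D : ℕ}
    (A : Fin d → Fin D → Fin D → Fin D → Fin D → ℂ) (N1 N2 : ℕ) :
    (Fin N1 × Fin N2 → Fin d) → ℂ :=
  fun i =>
    ∑ H : Fin N1 × Fin N2 → Fin D, ∑ V : Fin N1 × Fin N2 → Fin D,
      ∏ p : Fin N1 × Fin N2,
        A (i p) (H (cyc p.1 (N1 - 1), p.2)) (H p) (V p) (V (p.1, cyc p.2 (N2 - 1)))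

/-- A plaquette operator `O` acting on the four sites
`(x,y), (x+1,y), (x,y+1), (x+1,y+1)` of the torus. -/
noncomputable def plaqOp {d N1 N2 : ℕ}
    (O : (Fin d × Fin d × Fin d × Fin d) → (Fin d × Fin d × Fin d × Fin d) → ℂ)
    (p : Fin N1 × Fin N2) :
    Matrix (Fin N1 × Fin N2 → Fin d) (Fin N1 × Fin N2 → Fin d) ℂ :=
  Matrix.of fun s t =>
    O (s p, s (cyc p.1 1, p.2), s (p.1, cyc p.2 1), s (cyc p.1 1, cyc p.2 1))
      (t p, t (cyc p.1 1, p.2), t (p.1, cyc p.2 1), t (cyc p.1 1, cyc p.2 1)) *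
      (if ∀ m : Fin N1 × Fin N2,
          m ≠ p → m ≠ (cyc p.1 1, p.2) → m ≠ (p.1, cyc p.2 1) →
            m ≠ (cyc p.1 1, cyc p.2 1) → s m = t m then 1 else 0)

/-- The 2×2 patch tensor of a PEPS tensor `A`, with physical indices
`i₁ i₂ i₃ i₄` on sites `(x,y), (x+1,y), (x,y+1), (x+1,y+1)` and external virtual
indices `l₁ l₃ r₂ r₄ w₁ w₂ u₃ u₄`; the internal bonds `h_b, h_t, v_l, v_r` are
contracted. -/
noncomputable def patch {d D : ℕ}
    (A : Fin d → Fin D → Fin D → Fin D → Fin D → ℂ)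
    (i1 i2 i3 i4 : Fin d) (l1 l3 r2 r4 w1 w2 u3 u4 : Fin D) : ℂ :=
  ∑ hb : Fin D, ∑ ht : Fin D, ∑ vl : Fin D, ∑ vr : Fin D,
    A i1 l1 hb vl w1 * A i2 hb r2 vr w2 * A i3 l3 ht u3 vl * A i4 ht r4 u4 vr

section Torus

variable {S : Type*} [Fintype S] [DecidableEq S] {d D : ℕ}

theorem sum_sum_update (a : S) (f : (S → Fin D) → ℂ) :
    ∑ c : S → Fin D, ∑ h : Fin D, f (Function.update c a h) = D * ∑ c, f c := by
  have hinv : Function.Involutive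
      fun x : (S → Fin D) × Fin D => (Function.update x.1 a x.2, x.1 a) := by
    rintro ⟨c, h⟩
    simp
  have := Equiv.sum_comp hinv.toPerm fun x : (S → Fin D) × Fin D => f x.1
  simp only [Fintype.sum_prod_type, Function.Involutive.coe_toPerm] at this
  simp [this, Finset.mul_sum]

/-- Contracting the horizontal bonds `a, b` and the vertical bonds `a', b'` inside the sum over
all bond configurations only overcounts by a factor `D ^ 4`. -/
theorem sum_bonds_update (a b a' b' : S) (f : (S → Fin D) → (S → Fin D) → ℂ) :
    ∑ H : S → Fin D, ∑ V : S → Fin D, ∑ hb : Fin D, ∑ ht : Fin D, ∑ vl : Fin D, ∑ vr : Fin D,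
      f (Function.update (Function.update H a hb) b ht)
        (Function.update (Function.update V a' vl) b' vr) =
    (D : ℂ) ^ 4 * ∑ H, ∑ V, f H V := by
  have hV (g : (S → Fin D) → ℂ) : ∑ V : S → Fin D, ∑ vl : Fin D, ∑ vr : Fin D,
      g (Function.update (Function.update V a' vl) b' vr) = (D : ℂ) ^ 2 * ∑ V, g V := by
    rw [sum_sum_update a' fun V => ∑ vr, g (Function.update V b' vr), sum_sum_update b' g]
    ring
  have hH (g : (S → Fin D) → ℂ) : ∑ H : S → Fin D, ∑ hb : Fin D, ∑ ht : Fin D,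
      g (Function.update (Function.update H a hb) b ht) = (D : ℂ) ^ 2 * ∑ H, g H := by
    rw [sum_sum_update a fun H => ∑ ht, g (Function.update H b ht), sum_sum_update b g]
    ring
  calc _ = ∑ H : S → Fin D, ∑ hb : Fin D, ∑ ht : Fin D, ∑ V : S → Fin D, ∑ vl : Fin D,
        ∑ vr : Fin D, f (Function.update (Function.update H a hb) b ht)
          (Function.update (Function.update V a' vl) b' vr) := by
        refine Finset.sum_congr rfl fun H _ => ?_
        rw [Finset.sum_comm]
        refine Finset.sum_congr rfl fun hb _ => ?_
        rw [Finset.sum_comm]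
    _ = _ := by
        simp only [hV]
        rw [hH fun H => (D : ℂ) ^ 2 * ∑ V, f H V, ← Finset.mul_sum]
        ring

/-- Two insertions agree inside an environment `E` that does not involve the bonds
`a, b, a', b'` as soon as their contractions over these bonds agree. -/
theorem sum_env_congr (hD : 1 ≤ D) {a b a' b' : S} {E F G : (S → Fin D) → (S → Fin D) → ℂ}
    (hE : ∀ H V hb ht vl vr,
      E (Function.update (Function.update H a hb) b ht)
        (Function.update (Function.update V a' vl) b' vr) = E H V)
    (h : ∀ H V,
      ∑ hb : Fin D, ∑ ht : Fin D, ∑ vl : Fin D, ∑ vr : Fin D,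
        F (Function.update (Function.update H a hb) b ht)
          (Function.update (Function.update V a' vl) b' vr) =
      ∑ hb : Fin D, ∑ ht : Fin D, ∑ vl : Fin D, ∑ vr : Fin D,
        G (Function.update (Function.update H a hb) b ht)
          (Function.update (Function.update V a' vl) b' vr)) :
    ∑ H, ∑ V, E H V * F H V = ∑ H, ∑ V, E H V * G H V := by
  have hD0 : (D : ℂ) ^ 4 ≠ 0 := pow_ne_zero _ (by exact_mod_cast (by omega : D ≠ 0))
  apply mul_left_cancel₀ hD0
  rw [← sum_bonds_update a b a' b' fun H V => E H V * F H V,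
    ← sum_bonds_update a b a' b' fun H V => E H V * G H V]
  simp only [hE, ← Finset.mul_sum, h]

/-- A sum over configurations that agree with `s` off four distinct sites is a sum over the
values at these sites. -/
theorem sum_agree_off_four {q1 q2 q3 q4 : S} (h12 : q1 ≠ q2) (h13 : q1 ≠ q3) (h14 : q1 ≠ q4)
    (h23 : q2 ≠ q3) (h24 : q2 ≠ q4) (h34 : q3 ≠ q4) (s : S → Fin d)
    (f : (S → Fin d) → ℂ) :
    ∑ t : S → Fin d,
      (if ∀ m, m ≠ q1 → m ≠ q2 → m ≠ q3 → m ≠ q4 → s m = t m then f t else 0) =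
    ∑ j1 : Fin d, ∑ j2 : Fin d, ∑ j3 : Fin d, ∑ j4 : Fin d,
      f (Function.update (Function.update (Function.update (Function.update s q1 j1) q2 j2)
        q3 j3) q4 j4) := by
  rw [← Finset.sum_filter]
  simp only [← Fintype.sum_prod_type']
  refine Finset.sum_bij' (fun t _ => (t q1, t q2, t q3, t q4))
    (fun j _ => Function.update (Function.update (Function.update (Function.update s q1 j.1)
      q2 j.2.1) q3 j.2.2.1) q4 j.2.2.2) ?_ ?_ ?_ ?_ ?_
  · simp
  · rintro ⟨j1, j2, j3, j4⟩ _
    simp +contextual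
  · intro t ht
    simp only [Finset.mem_filter, Finset.mem_univ, true_and] at ht
    funext m
    simp only [Function.update_apply]
    grind
  · rintro ⟨j1, j2, j3, j4⟩ _
    simp [*]
  · intro t ht
    simp only [Finset.mem_filter, Finset.mem_univ, true_and] at ht
    congr 1
    funext m
    simp only [Function.update_apply]
    grind

theorem prod_compl_eq_mul_prod_compl_insert (f : S → ℂ) {T : Finset S} {a : S} (ha : a ∉ T) :
    ∏ q ∈ Tᶜ, f q = f a * ∏ q ∈ (insert a T)ᶜ, f q := by
  rw [Finset.compl_insert, Finset.mul_prod_erase _ _ (by simpa using ha)]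

variable (A : Fin d → Fin D → Fin D → Fin D → Fin D → ℂ)
  (X Y : Fin d → Fin d → Fin D → Fin D → Fin D → Fin D → Fin D → Fin D → ℂ)
  (e1 e2 : Equiv.Perm S)

/-- The PEPS tensor at site `q`, where `e1` and `e2` are the unit translations. -/
def siteTensor (s : S → Fin d) (H V : S → Fin D) (q : S) : ℂ :=
  A (s q) (H (e1.symm q)) (H q) (V q) (V (e2.symm q))

/-- The PEPS of `A` on a lattice with unit translations `e1` and `e2`. -/
def latticePeps (s : S → Fin d) : ℂ :=
  ∑ H : S → Fin D, ∑ V : S → Fin D, ∏ q, siteTensor A e1 e2 s H V q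

/-- The tensor `X` on the two sites `p` and `e1 p`. -/
def horizontalTensor (s : S → Fin d) (H V : S → Fin D) (p : S) : ℂ :=
  X (s p) (s (e1 p)) (H (e1.symm p)) (H (e1 p)) (V p) (V (e2.symm p)) (V (e1 p))
    (V (e2.symm (e1 p)))

/-- The tensor `Y` on the two sites `p` and `e2 p`. -/
def verticalTensor (s : S → Fin d) (H V : S → Fin D) (p : S) : ℂ :=
  Y (s p) (s (e2 p)) (H (e1.symm p)) (H p) (V (e2.symm p)) (H (e1.symm (e2 p))) (H (e2 p))
    (V (e2 p))

/-- The PEPS of `A` with the tensors at `p` and `e1 p` replaced by `X`. -/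
def horizontalInsertion (s : S → Fin d) (p : S) : ℂ :=
  ∑ H : S → Fin D, ∑ V : S → Fin D, horizontalTensor X e1 e2 s H V p *
    ∏ q ∈ ({p, e1 p} : Finset S)ᶜ, siteTensor A e1 e2 s H V q

/-- The PEPS of `A` with the tensors at `p` and `e2 p` replaced by `Y`. -/
def verticalInsertion (s : S → Fin d) (p : S) : ℂ :=
  ∑ H : S → Fin D, ∑ V : S → Fin D, verticalTensor Y e1 e2 s H V p *
    ∏ q ∈ ({p, e2 p} : Finset S)ᶜ, siteTensor A e1 e2 s H V q

/-- The product of all tensors of the PEPS of `A` away from the plaquette at `p`. -/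
def plaquetteEnv (s : S → Fin d) (p : S) (H V : S → Fin D) : ℂ :=
  ∏ q ∈ ({p, e1 p, e2 p, e1 (e2 p)} : Finset S)ᶜ, siteTensor A e1 e2 s H V q

variable {A X Y e1 e2}

theorem plaquetteEnv_update_bonds (comm : ∀ p, e1 (e2 p) = e2 (e1 p))
    (s : S → Fin d) (p : S) (H V : S → Fin D) (hb ht vl vr : Fin D) :
    plaquetteEnv A e1 e2 s p (Function.update (Function.update H p hb) (e2 p) ht)
      (Function.update (Function.update V p vl) (e1 p) vr) = plaquetteEnv A e1 e2 s p H V := by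
  refine Finset.prod_congr rfl fun q hq => ?_
  simp only [Finset.mem_compl, Finset.mem_insert, Finset.mem_singleton, not_or] at hq
  obtain ⟨h1, h2, h3, h4⟩ := hq
  have h4' : q ≠ e2 (e1 p) := comm p ▸ h4
  simp [siteTensor, Equiv.symm_apply_eq, *]

theorem plaquetteEnv_update_sites (s : S → Fin d) (p : S) (H V : S → Fin D)
    (j1 j2 j3 j4 : Fin d) :
    plaquetteEnv A e1 e2 (Function.update (Function.update (Function.update
      (Function.update s p j1) (e1 p) j2) (e2 p) j3) (e1 (e2 p)) j4) p H V =
      plaquetteEnv A e1 e2 s p H V := by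
  refine Finset.prod_congr rfl fun q hq => ?_
  simp only [Finset.mem_compl, Finset.mem_insert, Finset.mem_singleton, not_or] at hq
  obtain ⟨h1, h2, h3, h4⟩ := hq
  simp [siteTensor, *]

theorem latticePeps_eq_sum_env (n1 : ∀ p, p ≠ e1 p) (n2 : ∀ p, p ≠ e2 p)
    (n12 : ∀ p, e1 p ≠ e2 p) (n3 : ∀ p, p ≠ e1 (e2 p)) (s : S → Fin d) (p : S) :
    latticePeps A e1 e2 s = ∑ H, ∑ V, plaquetteEnv A e1 e2 s p H V *
      (siteTensor A e1 e2 s H V p * siteTensor A e1 e2 s H V (e1 p) *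
        siteTensor A e1 e2 s H V (e2 p) * siteTensor A e1 e2 s H V (e1 (e2 p))) := by
  refine Finset.sum_congr rfl fun H _ => Finset.sum_congr rfl fun V _ => ?_
  rw [← Finset.prod_mul_prod_compl {p, e1 p, e2 p, e1 (e2 p)}, mul_comm, plaquetteEnv]
  congr 1
  rw [Finset.prod_insert (by simp [n1, n2, n3]), Finset.prod_insert (by simp [n2, n12]),
    Finset.prod_insert (by simp [n1]), Finset.prod_singleton]
  ring

theorem horizontalInsertion_eq_sum_env (n1 : ∀ p, p ≠ e1 p) (n2 : ∀ p, p ≠ e2 p)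
    (n12 : ∀ p, e1 p ≠ e2 p) (n3 : ∀ p, p ≠ e1 (e2 p))
    (s : S → Fin d) (p : S) :
    horizontalInsertion A X e1 e2 s p = ∑ H, ∑ V, plaquetteEnv A e1 e2 s p H V *
      (horizontalTensor X e1 e2 s H V p * siteTensor A e1 e2 s H V (e2 p) *
        siteTensor A e1 e2 s H V (e1 (e2 p))) := by
  refine Finset.sum_congr rfl fun H _ => Finset.sum_congr rfl fun V _ => ?_
  rw [prod_compl_eq_mul_prod_compl_insert _ (a := e2 p) (by simp [(n2 _).symm, (n12 _).symm]),
    prod_compl_eq_mul_prod_compl_insert _ (a := e1 (e2 p))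
      (by simp [(n1 _).symm, (n3 _).symm, (n2 _).symm]), plaquetteEnv]
  rw [show (insert (e1 (e2 p)) (insert (e2 p) {p, e1 p}) : Finset S) =
    {p, e1 p, e2 p, e1 (e2 p)} by grind]
  ring

theorem horizontalInsertion_up_eq_sum_env (n1 : ∀ p, p ≠ e1 p) (n2 : ∀ p, p ≠ e2 p)
    (n12 : ∀ p, e1 p ≠ e2 p) (n3 : ∀ p, p ≠ e1 (e2 p))
    (s : S → Fin d) (p : S) :
    horizontalInsertion A X e1 e2 s (e2 p) = ∑ H, ∑ V, plaquetteEnv A e1 e2 s p H V *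
      (siteTensor A e1 e2 s H V p * siteTensor A e1 e2 s H V (e1 p) *
        horizontalTensor X e1 e2 s H V (e2 p)) := by
  refine Finset.sum_congr rfl fun H _ => Finset.sum_congr rfl fun V _ => ?_
  rw [prod_compl_eq_mul_prod_compl_insert _ (a := e1 p) (by simp [n2, n12]),
    prod_compl_eq_mul_prod_compl_insert _ (a := p) (by simp [n1, n2, n3]), plaquetteEnv]
  ring

theorem verticalInsertion_eq_sum_env (n1 : ∀ p, p ≠ e1 p) (n2 : ∀ p, p ≠ e2 p)
    (n12 : ∀ p, e1 p ≠ e2 p) (n3 : ∀ p, p ≠ e1 (e2 p))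
    (s : S → Fin d) (p : S) :
    verticalInsertion A Y e1 e2 s p = ∑ H, ∑ V, plaquetteEnv A e1 e2 s p H V *
      (verticalTensor Y e1 e2 s H V p * siteTensor A e1 e2 s H V (e1 p) *
        siteTensor A e1 e2 s H V (e1 (e2 p))) := by
  refine Finset.sum_congr rfl fun H _ => Finset.sum_congr rfl fun V _ => ?_
  rw [prod_compl_eq_mul_prod_compl_insert _ (a := e1 p) (by simp [(n1 _).symm, n12]),
    prod_compl_eq_mul_prod_compl_insert _ (a := e1 (e2 p))
      (by simp [(n1 _).symm, (n3 _).symm, (n2 _).symm]), plaquetteEnv]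
  rw [show (insert (e1 (e2 p)) (insert (e1 p) {p, e2 p}) : Finset S) =
    {p, e1 p, e2 p, e1 (e2 p)} by grind]
  ring

theorem verticalInsertion_right_eq_sum_env (comm : ∀ p, e1 (e2 p) = e2 (e1 p))
    (n1 : ∀ p, p ≠ e1 p) (n2 : ∀ p, p ≠ e2 p)
    (n12 : ∀ p, e1 p ≠ e2 p) (n3 : ∀ p, p ≠ e1 (e2 p))
    (s : S → Fin d) (p : S) :
    verticalInsertion A Y e1 e2 s (e1 p) = ∑ H, ∑ V, plaquetteEnv A e1 e2 s p H V *
      (siteTensor A e1 e2 s H V p * siteTensor A e1 e2 s H V (e2 p) *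
        verticalTensor Y e1 e2 s H V (e1 p)) := by
  refine Finset.sum_congr rfl fun H _ => Finset.sum_congr rfl fun V _ => ?_
  rw [← comm, prod_compl_eq_mul_prod_compl_insert _ (a := e2 p)
      (by simp [(n12 _).symm, n1]),
    prod_compl_eq_mul_prod_compl_insert _ (a := p) (by simp [n1, n2, n3]), plaquetteEnv]
  rw [show (insert p (insert (e2 p) {e1 p, e1 (e2 p)}) : Finset S) =
    {p, e1 p, e2 p, e1 (e2 p)} by grind]
  ring

/-- The local telescoping equation on a single plaquette of the lattice, up to the factor `D`
coming from the bond that is no longer contracted when `X` or `Y` is inserted. -/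
theorem plaquette_telescope (hD : 1 ≤ D)
    (O : (Fin d × Fin d × Fin d × Fin d) → (Fin d × Fin d × Fin d × Fin d) → ℂ) (ε0 : ℂ)
    (hloc : ∀ (i1 i2 i3 i4 : Fin d) (l1 l3 r2 r4 w1 w2 u3 u4 : Fin D),
      (∑ j1 : Fin d, ∑ j2 : Fin d, ∑ j3 : Fin d, ∑ j4 : Fin d,
          O (i1, i2, i3, i4) (j1, j2, j3, j4) *
            patch A j1 j2 j3 j4 l1 l3 r2 r4 w1 w2 u3 u4)
          - ε0 * patch A i1 i2 i3 i4 l1 l3 r2 r4 w1 w2 u3 u4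
        = (∑ ht : Fin D, ∑ vl : Fin D, ∑ vr : Fin D,
            X i1 i2 l1 r2 vl w1 vr w2 * A i3 l3 ht u3 vl * A i4 ht r4 u4 vr)
          - (∑ hb : Fin D, ∑ vl : Fin D, ∑ vr : Fin D,
            A i1 l1 hb vl w1 * A i2 hb r2 vr w2 * X i3 i4 l3 r4 u3 vl u4 vr)
          + (∑ hb : Fin D, ∑ ht : Fin D, ∑ vr : Fin D,
            Y i1 i3 l1 hb w1 l3 ht u3 * A i2 hb r2 vr w2 * A i4 ht r4 u4 vr)
          - (∑ hb : Fin D, ∑ ht : Fin D, ∑ vl : Fin D,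
            A i1 l1 hb vl w1 * A i3 l3 ht u3 vl * Y i2 i4 hb r2 w2 ht r4 u4))
    (comm : ∀ p, e1 (e2 p) = e2 (e1 p)) (n1 : ∀ p, p ≠ e1 p) (n2 : ∀ p, p ≠ e2 p)
    (n12 : ∀ p, e1 p ≠ e2 p) (n3 : ∀ p, p ≠ e1 (e2 p)) (s : S → Fin d) (p : S) :
    D * (∑ t : S → Fin d, O (s p, s (e1 p), s (e2 p), s (e1 (e2 p)))
        (t p, t (e1 p), t (e2 p), t (e1 (e2 p))) *
        (if ∀ m, m ≠ p → m ≠ e1 p → m ≠ e2 p → m ≠ e1 (e2 p) → s m = t m then 1 else 0) *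
        latticePeps A e1 e2 t - ε0 * latticePeps A e1 e2 s) =
      horizontalInsertion A X e1 e2 s p - horizontalInsertion A X e1 e2 s (e2 p) +
        verticalInsertion A Y e1 e2 s p - verticalInsertion A Y e1 e2 s (e1 p) := by
  have hd (p : S) : e2.symm (e1 (e2 p)) = e1 p := by simp [comm]
  have hO : ∑ t : S → Fin d, O (s p, s (e1 p), s (e2 p), s (e1 (e2 p)))
        (t p, t (e1 p), t (e2 p), t (e1 (e2 p))) *
        (if ∀ m, m ≠ p → m ≠ e1 p → m ≠ e2 p → m ≠ e1 (e2 p) → s m = t m then 1 else 0) *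
        latticePeps A e1 e2 t =
      ∑ H, ∑ V, plaquetteEnv A e1 e2 s p H V * ∑ j1, ∑ j2, ∑ j3, ∑ j4,
        O (s p, s (e1 p), s (e2 p), s (e1 (e2 p))) (j1, j2, j3, j4) *
          (A j1 (H (e1.symm p)) (H p) (V p) (V (e2.symm p)) *
          A j2 (H p) (H (e1 p)) (V (e1 p)) (V (e2.symm (e1 p))) *
          A j3 (H (e1.symm (e2 p))) (H (e2 p)) (V (e2 p)) (V p) *
          A j4 (H (e2 p)) (H (e1 (e2 p))) (V (e1 (e2 p))) (V (e1 p))) := by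
    simp only [mul_assoc, ite_mul, mul_ite, one_mul, zero_mul, mul_zero]
    rw [sum_agree_off_four (n1 p) (n2 p) (n3 p) (n12 p) (fun h => n2 p (e1.injective h))
      (n1 _)]
    simp only [latticePeps_eq_sum_env n1 n2 n12 n3 _ p, plaquetteEnv_update_sites, siteTensor,
      Equiv.symm_apply_apply, hd]
    simp only [Function.update_apply, n1, n2, n3, n12, (n1 _).symm, (n2 _).symm,
      (n3 _).symm, (n12 _).symm, e1.injective.eq_iff, if_true, if_false, Finset.mul_sum]
    simp only [Finset.sum_comm (s := (Finset.univ : Finset (Fin d)))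
      (t := (Finset.univ : Finset (S → Fin D)))]
    refine Finset.sum_congr rfl fun H _ => Finset.sum_congr rfl fun V _ =>
      Finset.sum_congr rfl fun j1 _ => Finset.sum_congr rfl fun j2 _ =>
      Finset.sum_congr rfl fun j3 _ => Finset.sum_congr rfl fun j4 _ => ?_
    ring
  rw [hO, latticePeps_eq_sum_env n1 n2 n12 n3 s p,
    horizontalInsertion_eq_sum_env n1 n2 n12 n3, horizontalInsertion_up_eq_sum_env n1 n2 n12 n3,
    verticalInsertion_eq_sum_env n1 n2 n12 n3,
    verticalInsertion_right_eq_sum_env comm n1 n2 n12 n3]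
  simp only [Finset.mul_sum (s := (Finset.univ : Finset (S → Fin D))),
    ← Finset.sum_sub_distrib, ← Finset.sum_add_distrib,
    mul_left_comm _ (plaquetteEnv _ _ _ _ _ _ _),
    ← mul_sub, ← mul_add]
  refine sum_env_congr hD (a := p) (b := e2 p) (a' := p) (b' := e1 p)
    (plaquetteEnv_update_bonds comm s p) fun H V => ?_
  have hl := congrArg ((D : ℂ) * ·) (hloc (s p) (s (e1 p)) (s (e2 p)) (s (e1 (e2 p)))
    (H (e1.symm p)) (H (e1.symm (e2 p))) (H (e1 p)) (H (e1 (e2 p)))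
    (V (e2.symm p)) (V (e2.symm (e1 p))) (V (e2 p)) (V (e1 (e2 p))))
  simp only [patch] at hl
  simp only [siteTensor, horizontalTensor, verticalTensor, Equiv.symm_apply_apply, hd, ← comm,
    Function.update_apply, Equiv.symm_apply_eq, n1, n2, n3, n12, (n1 _).symm, (n2 _).symm,
    (n3 _).symm, (n12 _).symm, e1.injective.eq_iff, if_true, if_false]
  convert hl using 1
  · simp only [Finset.sum_sub_distrib, Finset.mul_sum, mul_sub,
      Finset.sum_comm (s := (Finset.univ : Finset (Fin d)))
        (t := (Finset.univ : Finset (Fin D)))]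
  · simp only [Finset.sum_sub_distrib, Finset.sum_add_distrib, Finset.mul_sum, mul_sub, mul_add,
      Finset.sum_const, Finset.card_univ, Fintype.card_fin, nsmul_eq_mul]

end Torus

theorem cyc_cyc {N : ℕ} (a : Fin N) (s t : ℕ) : cyc (cyc a s) t = cyc a (s + t) := by
  ext
  simp [cyc, add_assoc]

theorem cyc_self {N : ℕ} (a : Fin N) : cyc a N = a := by
  ext
  simp [cyc, Nat.mod_eq_of_lt a.isLt]

theorem cyc_one_ne {N : ℕ} (hN : 2 ≤ N) (a : Fin N) : cyc a 1 ≠ a := by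
  intro h
  have h' : (a.val + 1) % N = a.val := congrArg Fin.val h
  have ha := a.isLt
  rcases Nat.lt_or_ge (a.val + 1) N with hlt | hge
  · rw [Nat.mod_eq_of_lt hlt] at h'
    omega
  · rw [show a.val + 1 = N by omega, Nat.mod_self] at h'
    omega

/-- The unit shift of `Fin N`. -/
def cycEquiv (N : ℕ) : Equiv.Perm (Fin N) where
  toFun a := cyc a 1
  invFun a := cyc a (N - 1)
  left_inv a := by
    beta_reduce
    rw [cyc_cyc, Nat.add_sub_cancel' (by have := a.isLt; omega), cyc_self]
  right_inv a := by
    beta_reduce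
    rw [cyc_cyc, Nat.sub_add_cancel (by have := a.isLt; omega), cyc_self]

/-- If a PEPS tensor `A`, a plaquette operator `O` and `ε₀ ∈ ℂ`
admit tensors `X` and `Y` satisfying the local 2D telescoping equation on 2×2
patches, then for all `N₁, N₂ ≥ 2` the PEPS on the `N₁ × N₂` torus is an
eigenstate: `𝒪 ψ = N₁ N₂ ε₀ ψ` with `𝒪 = Σ_{(x,y)} O_{(x,y)}`. -/
theorem peps_eigenstate_of_local_telescopes
    (d D : ℕ) (hd : 1 ≤ d) (hD : 1 ≤ D)
    (A : Fin d → Fin D → Fin D → Fin D → Fin D → ℂ)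
    (O : (Fin d × Fin d × Fin d × Fin d) → (Fin d × Fin d × Fin d × Fin d) → ℂ)
    (ε0 : ℂ)
    (X Y : Fin d → Fin d → Fin D → Fin D → Fin D → Fin D → Fin D → Fin D → ℂ)
    (hloc : ∀ (i1 i2 i3 i4 : Fin d) (l1 l3 r2 r4 w1 w2 u3 u4 : Fin D),
      (∑ j1 : Fin d, ∑ j2 : Fin d, ∑ j3 : Fin d, ∑ j4 : Fin d,
          O (i1, i2, i3, i4) (j1, j2, j3, j4) *
            patch A j1 j2 j3 j4 l1 l3 r2 r4 w1 w2 u3 u4)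
          - ε0 * patch A i1 i2 i3 i4 l1 l3 r2 r4 w1 w2 u3 u4
        = (∑ ht : Fin D, ∑ vl : Fin D, ∑ vr : Fin D,
            X i1 i2 l1 r2 vl w1 vr w2 * A i3 l3 ht u3 vl * A i4 ht r4 u4 vr)
          - (∑ hb : Fin D, ∑ vl : Fin D, ∑ vr : Fin D,
            A i1 l1 hb vl w1 * A i2 hb r2 vr w2 * X i3 i4 l3 r4 u3 vl u4 vr)
          + (∑ hb : Fin D, ∑ ht : Fin D, ∑ vr : Fin D,
            Y i1 i3 l1 hb w1 l3 ht u3 * A i2 hb r2 vr w2 * A i4 ht r4 u4 vr)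
          - (∑ hb : Fin D, ∑ ht : Fin D, ∑ vl : Fin D,
            A i1 l1 hb vl w1 * A i3 l3 ht u3 vl * Y i2 i4 hb r2 w2 ht r4 u4)) :
    ∀ N1 N2 : ℕ, 2 ≤ N1 → 2 ≤ N2 →
      (∑ p : Fin N1 × Fin N2, plaqOp O p).mulVec (peps A N1 N2)
        = (((N1 : ℂ) * (N2 : ℂ)) * ε0) • peps A N1 N2 := by
  intro N1 N2 hN1 hN2
  let e1 : Equiv.Perm (Fin N1 × Fin N2) := (cycEquiv N1).prodCongr (Equiv.refl _)
  let e2 : Equiv.Perm (Fin N1 × Fin N2) := (Equiv.refl _).prodCongr (cycEquiv N2)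
  have hpeps : peps A N1 N2 = latticePeps A e1 e2 := rfl
  have hD0 : (D : ℂ) ≠ 0 := by exact_mod_cast (by omega : D ≠ 0)
  funext s
  have key := Finset.sum_congr rfl fun p (_ : p ∈ Finset.univ) =>
    plaquette_telescope (e1 := e1) (e2 := e2) hD O ε0 hloc (fun _ => rfl)
      (fun p h => cyc_one_ne hN1 p.1 (congrArg Prod.fst h).symm)
      (fun p h => cyc_one_ne hN2 p.2 (congrArg Prod.snd h).symm)
      (fun p h => cyc_one_ne hN1 p.1 (congrArg Prod.fst h))
      (fun p h => cyc_one_ne hN1 p.1 (congrArg Prod.fst h).symm) s p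
  simp only [← Finset.mul_sum, Finset.sum_sub_distrib, Finset.sum_add_distrib,
    Equiv.sum_comp e1 (verticalInsertion A Y e1 e2 s),
    Equiv.sum_comp e2 (horizontalInsertion A X e1 e2 s), sub_self, zero_add] at key
  have key' := sub_eq_zero.mp ((mul_eq_zero.mp key).resolve_left hD0)
  rw [Matrix.sum_mulVec, Finset.sum_apply, hpeps, Pi.smul_apply, smul_eq_mul]
  refine Eq.trans ?_ (key'.trans ?_)
  · rfl
  · simp only [Finset.sum_const, Finset.card_univ, Fintype.card_prod, Fintype.card_fin,
      nsmul_eq_mul, Nat.cast_mul]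
    ring
end
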